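/- arXiv:1110.3107 — 12 statements merged into one kernel-verified Lean document; each statement's English description precedes it below -/
import Mathlib

section
/- Let D = (V,A) be a digraph on n vertices admitting an acyclic ordering g, i.e., a bijection g : V → {1,…,n} such that g(x) < g(y) for every arc (x,y) ∈ A. Then ⟨e,g⟩ ≥ (1/2)·⟨e,e⟩, i.e., 2·Σ_{x∈V} e(x)·g(x) ≥ Σ_{x∈V} e(x)², where e is the e-vector of D. -/
open Finset


/-- Pointwise inequality on triples. -/
lemma aux_point (x y z : ℕ) (p q r u v w : ℤ)
    (hxy : (x < y ∧ u = -1 ∧ (p = 0 ∨ p = -1)) ∨ (y < x ∧ u = 1 ∧ (p = 0 ∨ p = 1)) ∨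
      (x = y ∧ u = 0 ∧ p = 0))
    (hxz : (x < z ∧ v = -1 ∧ (q = 0 ∨ q = -1)) ∨ (z < x ∧ v = 1 ∧ (q = 0 ∨ q = 1)) ∨
      (x = z ∧ v = 0 ∧ q = 0))
    (hyz : (y < z ∧ w = -1 ∧ (r = 0 ∨ r = -1)) ∨ (z < y ∧ w = 1 ∧ (r = 0 ∨ r = 1)) ∨
      (y = z ∧ w = 0 ∧ r = 0))
    (hpq : x = y → q = r) (hpr : x = z → p = -r) (hqr : y = z → p = q) :
    0 ≤ p * (v - q) + q * (u - p) + (-p) * (w - r) + r * (-u - -p)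
      + (-q) * (-w - -r) + (-r) * (-v - -q) := by
  rcases hxy with ⟨h1, rfl, rfl | rfl⟩ | ⟨h1, rfl, rfl | rfl⟩ | ⟨h1, rfl, rfl⟩ <;>
  rcases hxz with ⟨h2, rfl, rfl | rfl⟩ | ⟨h2, rfl, rfl | rfl⟩ | ⟨h2, rfl, rfl⟩ <;>
  rcases hyz with ⟨h3, rfl, rfl | rfl⟩ | ⟨h3, rfl, rfl | rfl⟩ | ⟨h3, rfl, rfl⟩ <;>
  omega


/-- Theorem 1 of the paper: for any digraph `D = (V,A)` on `n` vertices admitting an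
acyclic ordering `g : V → {1,…,n}`, the `e`-vector satisfies `⟨e,g⟩ ≥ (1/2)⟨e,e⟩`. -/
theorem stmt_0 {V : Type*} [Fintype V] [DecidableEq V]
    (A : V → V → Prop) [DecidableRel A]
    (hA : ∀ x y, A x y → x ≠ y)
    (n : ℕ) (hn : Fintype.card V = n)
    (e : V → ℤ)
    (he : ∀ x, e x = ((Finset.univ.filter (fun z => A z x)).card : ℤ)
                    - ((Finset.univ.filter (fun z => A x z)).card : ℤ))
    (g : V → ℕ)
    (hg_inj : Function.Injective g)
    (hg_mem : ∀ x, g x ∈ Finset.Icc 1 n)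
    (hg_ord : ∀ x y, A x y → g x < g y) :
    2 * ∑ x, e x * (g x : ℤ) ≥ ∑ x, e x * e x := by
  classical
  set b : V → V → ℤ := fun i j => (if A j i then 1 else 0) - (if A i j then 1 else 0) with hbdef
  set s : V → V → ℤ := fun i j => (if g j < g i then 1 else 0) - (if g i < g j then 1 else 0)
    with hsdef
  have hb_anti : ∀ i j, b j i = - b i j := by intro i j; simp [hbdef]
  have hs_anti : ∀ i j, s j i = - s i j := by intro i j; simp [hsdef]
  have heb : ∀ i, e i = ∑ j, b i j := by
    intro i
    rw [he i]; simp [hbdef, Finset.sum_sub_distrib]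
  have hprop : ∀ i j, (g i < g j ∧ s i j = -1 ∧ (b i j = 0 ∨ b i j = -1)) ∨
      (g j < g i ∧ s i j = 1 ∧ (b i j = 0 ∨ b i j = 1)) ∨
      (g i = g j ∧ s i j = 0 ∧ b i j = 0) := by
    intro i j
    have h1 := hg_ord i j
    have h2 := hg_ord j i
    simp only [hbdef, hsdef]
    split_ifs <;> grind
  have hsum0 : ∑ i, e i = 0 := by
    have h1 : ∑ i, e i = ∑ i, ∑ j, b i j := Finset.sum_congr rfl fun i _ => heb i
    have h2 : ∑ i, ∑ j, b i j = ∑ i, ∑ j, b j i := Finset.sum_comm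
    have h3 : ∑ i, ∑ j, b j i = - ∑ i, ∑ j, b i j := by
      simp only [← Finset.sum_neg_distrib]
      exact Finset.sum_congr rfl fun i _ => Finset.sum_congr rfl fun j _ => hb_anti i j
    omega
  have hss : ∀ i, ∑ j, s i j = 2 * (g i : ℤ) - n - 1 := by
    intro i
    have hL : (univ.filter (fun j => g j < g i)).card ≤ g i - 1 := by
      have := Finset.card_le_card_of_injOn (s := univ.filter (fun j => g j < g i))
        (t := Finset.Ico 1 (g i)) g (by
          intro j hj
          have := hg_mem j
          simp at hj this ⊢
          omega) hg_inj.injOn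
      simpa using this
    have hU : (univ.filter (fun j => g i < g j)).card ≤ n - g i := by
      have := Finset.card_le_card_of_injOn (s := univ.filter (fun j => g i < g j))
        (t := Finset.Ioc (g i) n) g (by
          intro j hj
          have := hg_mem j
          simp at hj this ⊢
          omega) hg_inj.injOn
      simpa using this
    have hT : (univ.filter (fun j => g j < g i)).card + (univ.filter (fun j => g i < g j)).card
        + 1 = n := by
      rw [← hn, ← Finset.card_univ]
      have h0 : ∀ j : V, (if g j < g i then 1 else 0) + (if g i < g j then 1 else 0)
          + (if j = i then 1 else 0) = 1 := by
        intro j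
        by_cases hji : j = i
        · simp [hji]
        · have : g j ≠ g i := fun h => hji (hg_inj h)
          rcases lt_or_gt_of_ne this with h | h
          · simp [hji, h, h.le]
          · simp [hji, h, h.le]
      have := Finset.sum_congr (rfl : (univ : Finset V) = univ) (fun j _ => h0 j)
      simp only [Finset.sum_add_distrib] at this
      simpa using this
    have hm := hg_mem i
    simp only [Finset.mem_Icc] at hm
    have : ∑ j, s i j = ((univ.filter (fun j => g j < g i)).card : ℤ)
        - ((univ.filter (fun j => g i < g j)).card : ℤ) := by
      simp [hsdef, Finset.sum_sub_distrib]
    rw [this]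
    omega
  set F : V → V → V → ℤ := fun i j k => b i j * (s i k - b i k) with hF
  have hS : 2 * ∑ x, e x * (g x : ℤ) - ∑ x, e x * e x = ∑ i, ∑ j, ∑ k, F i j k := by
    have h1 : ∀ i, ∑ j, ∑ k, F i j k = e i * (2 * (g i : ℤ) - n - 1 - e i) := by
      intro i
      rw [← hss i, heb i, ← Finset.sum_sub_distrib, Finset.sum_mul_sum]
    simp only [h1]
    have h2 : ∀ i, e i * (2 * (g i : ℤ) - n - 1 - e i)
        = 2 * (e i * (g i : ℤ)) - (n + 1) * e i - e i * e i := by intro i; ring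
    simp only [h2, Finset.sum_sub_distrib, ← Finset.mul_sum, hsum0]
    ring
  have hpt : ∀ i j k, 0 ≤ F i j k + F i k j + F j i k + F j k i + F k i j + F k j i := by
    intro i j k
    have := aux_point (g i) (g j) (g k) (b i j) (b i k) (b j k) (s i j) (s i k) (s j k)
      (hprop i j) (hprop i k) (hprop j k)
      (fun h => by rw [hg_inj h]) (fun h => by rw [hg_inj h, hb_anti])
      (fun h => by rw [hg_inj h])
    simp only [hF]
    rw [hb_anti i j, hb_anti i k, hb_anti j k, hs_anti i j, hs_anti i k, hs_anti j k]
    exact this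
  have hsw : ∀ G : V → V → V → ℤ, ∑ i, ∑ j, ∑ k, G i j k = ∑ i, ∑ j, ∑ k, G j i k :=
    fun G => Finset.sum_comm
  have hsw2 : ∀ G : V → V → V → ℤ, ∑ i, ∑ j, ∑ k, G i j k = ∑ i, ∑ j, ∑ k, G i k j :=
    fun G => Finset.sum_congr rfl fun i _ => Finset.sum_comm
  have hnn : 0 ≤ ∑ i, ∑ j, ∑ k,
      (F i j k + F i k j + F j i k + F j k i + F k i j + F k j i) :=
    Finset.sum_nonneg fun i _ => Finset.sum_nonneg fun j _ => Finset.sum_nonneg fun k _ =>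
      hpt i j k
  simp only [Finset.sum_add_distrib] at hnn
  have e1 := hsw2 F
  have e2 := hsw F
  have e3 := hsw (fun i j k => F i k j)
  have e4 := hsw2 (fun i j k => F j i k)
  have e5 := hsw2 (fun i j k => F j k i)
  linarith
end

section
/- Let D = (V,A) be a digraph on n vertices with e-vector e, and let g : V → {1,…,n} be an acyclic ordering of D satisfying the equality 2·⟨e,g⟩ = ⟨e,e⟩. Define f : V → ℤ by f(x) = n + 1 − g(x) + e(x). Then f is a bijection from V onto {1,…,n}, f is an acyclic ordering of D, and for all distinct x,y ∈ V one has (x,y) ∈ A if and only if f(x) < f(y) and g(x) < g(y). -/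
open Finset

open Classical in
lemma cyc_le (p p' q q' r r' : Prop) (a1 : p → ¬ p') (a2 : q → ¬ q') (a3 : r → ¬ r') :
    (if p' then (1:ℤ) else 0) * (if r then 1 else 0) * 1
      + (if q' then 1 else 0) * (if p then 1 else 0) * 1
      + (if r' then 1 else 0) * (if q then 1 else 0) * 1 ≤ 1 := by
  by_cases p <;> by_cases q <;> by_cases r <;> simp_all <;> split_ifs <;> simp

lemma tri_sum {V : Type*} [Fintype V] [DecidableEq V] (t : V → V → ℤ)
    (ht : ∀ x y, t x y * t x y = t x y) :
    ∑ x, ∑ y, ∑ z, (t y x * t z x * (if y = z then 0 else 1)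
      + t z y * t x y * (if z = x then 0 else 1)
      + t x z * t y z * (if x = y then 0 else 1))
    = 3 * (∑ x, (∑ y, t y x) * (∑ y, t y x) - ∑ x, ∑ y, t y x) := by
  have key : ∑ x, ∑ y, ∑ z, (t y x * t z x * (if y = z then 0 else 1))
      = ∑ x, (∑ y, t y x) * (∑ y, t y x) - ∑ x, ∑ y, t y x := by
    rw [← Finset.sum_sub_distrib]
    refine Finset.sum_congr rfl fun x _ => ?_
    rw [Finset.sum_mul_sum, ← Finset.sum_sub_distrib]
    refine Finset.sum_congr rfl fun y _ => ?_
    have h1 : ∀ z, t y x * t z x * (if y = z then (0:ℤ) else 1)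
        = t y x * t z x - (if y = z then t y x else 0) := by
      intro z
      split_ifs with h
      · subst h; rw [ht]; ring
      · ring
    rw [Finset.sum_congr rfl fun z _ => h1 z, Finset.sum_sub_distrib]
    simp
  have k2 : ∑ x, ∑ y, ∑ z, (t z y * t x y * (if z = x then 0 else 1))
      = ∑ x, ∑ y, ∑ z, (t y x * t z x * (if y = z then 0 else 1)) := by
    rw [Finset.sum_comm]
    refine Finset.sum_congr rfl fun x _ => ?_
    rw [Finset.sum_comm]
  have k3 : ∑ x, ∑ y, ∑ z, (t x z * t y z * (if x = y then 0 else 1))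
      = ∑ x, ∑ y, ∑ z, (t y x * t z x * (if y = z then 0 else 1)) := by
    rw [Finset.sum_congr rfl fun x _ => Finset.sum_comm, Finset.sum_comm]
  simp only [Finset.sum_add_distrib]
  rw [k2, k3, key]; ring

set_option maxHeartbeats 1000000 in
/-- Theorem 2 of the paper: if an acyclic ordering `g` of a digraph `D` attains the
lower bound `2⟨e,g⟩ = ⟨e,e⟩`, then `f = n + 1 - g + e` is a bijection onto `{1,…,n}`,
`f` is an acyclic ordering of `D`, and `A = f ∩ g`. -/
theorem stmt_1 {V : Type*} [Fintype V] [DecidableEq V]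
    (A : V → V → Prop) [DecidableRel A]
    (hA : ∀ x y, A x y → x ≠ y)
    (n : ℕ) (hn : Fintype.card V = n)
    (e : V → ℤ)
    (he : ∀ x, e x = ((Finset.univ.filter (fun z => A z x)).card : ℤ)
                    - ((Finset.univ.filter (fun z => A x z)).card : ℤ))
    (g : V → ℕ)
    (hg_inj : Function.Injective g)
    (hg_mem : ∀ x, g x ∈ Finset.Icc 1 n)
    (hg_ord : ∀ x y, A x y → g x < g y)
    (heq : 2 * ∑ x, e x * (g x : ℤ) = ∑ x, e x * e x)
    (f : V → ℤ)
    (hf : ∀ x, f x = (n : ℤ) + 1 - (g x : ℤ) + e x) :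
    (∀ x, f x ∈ Finset.Icc (1 : ℤ) (n : ℤ)) ∧
    Function.Injective f ∧
    (∀ x y, A x y → f x < f y) ∧
    (∀ x y, x ≠ y → (A x y ↔ f x < f y ∧ g x < g y)) := by
  classical
  have himg : Finset.univ.image g = Finset.Icc 1 n := by
    apply Finset.eq_of_subset_of_card_le
    · intro k hk
      obtain ⟨x, -, rfl⟩ := Finset.mem_image.1 hk
      exact hg_mem x
    · rw [Finset.card_image_of_injective _ hg_inj, Finset.card_univ, hn]; simp
  have hcard : ∀ x, ((Finset.univ.filter (fun y => g x < g y)).card : ℤ) = n - g x := by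
    intro x
    have h1 : (Finset.univ.filter (fun y => g x < g y)).image g = Finset.Ioc (g x) n := by
      ext k
      simp only [Finset.mem_image, Finset.mem_filter, Finset.mem_univ, true_and, Finset.mem_Ioc]
      constructor
      · rintro ⟨y, hy, rfl⟩
        exact ⟨hy, (Finset.mem_Icc.1 (hg_mem y)).2⟩
      · rintro ⟨h1, h2⟩
        have : k ∈ Finset.univ.image g := by
          rw [himg, Finset.mem_Icc]; omega
        obtain ⟨y, -, rfl⟩ := Finset.mem_image.1 this
        exact ⟨y, h1, rfl⟩
    rw [← Finset.card_image_of_injective _ hg_inj, h1, Nat.card_Ioc]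
    have := (Finset.mem_Icc.1 (hg_mem x)).2
    omega
  -- the tournament
  obtain ⟨T, hT⟩ : ∃ T : V → V → Prop, ∀ y x, T y x ↔ (A y x ∨ (g x < g y ∧ ¬ A x y)) :=
    ⟨_, fun _ _ => Iff.rfl⟩
  have hTirr : ∀ x, ¬ T x x := by
    intro x h
    rcases (hT x x).1 h with h | h
    · exact hA x x h rfl
    · omega
  have hTasym : ∀ x y, T x y → ¬ T y x := by
    intro x y h h'
    rw [hT] at h h'
    have := hg_ord x y
    have := hg_ord y x
    rcases h with h | h <;> rcases h' with h' | h' <;> grind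
  have hTtot : ∀ x y, x ≠ y → T x y ∨ T y x := by
    intro x y hxy
    have : g x ≠ g y := fun h => hxy (hg_inj h)
    rw [hT, hT]
    have := hg_ord x y
    have := hg_ord y x
    by_cases h1 : A x y <;> by_cases h2 : A y x <;> simp [h1, h2] <;> omega
  obtain ⟨t, htd⟩ : ∃ t : V → V → ℤ, ∀ y x, t y x = if T y x then 1 else 0 := ⟨_, fun _ _ => rfl⟩
  obtain ⟨t0, ht0d⟩ : ∃ t : V → V → ℤ, ∀ y x, t y x = if g x < g y then 1 else 0 :=
    ⟨_, fun _ _ => rfl⟩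
  obtain ⟨a, had⟩ : ∃ t : V → V → ℤ, ∀ y x, t y x = if A y x then 1 else 0 := ⟨_, fun _ _ => rfl⟩
  have hta : ∀ y x, t y x = t0 y x + a y x - a x y := by
    intro y x
    rw [htd, ht0d, had, had]
    have h1 := hg_ord x y
    have h2 := hg_ord y x
    by_cases c1 : A x y <;> by_cases c2 : A y x <;> by_cases c3 : g x < g y <;>
      simp [hT, c1, c2, c3] <;> first | omega | (exfalso; have := h1 c1; omega) | (exfalso; have := h2 c2; omega)
  have he' : ∀ x, e x = ∑ y, a y x - ∑ y, a x y := by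
    intro x
    rw [he]
    simp [had]
  have hs0 : ∀ x, ∑ y, t0 y x = n - g x := by
    intro x
    rw [← hcard x]; simp [ht0d]
  have hs : ∀ x, ∑ y, t y x = n - g x + e x := by
    intro x
    rw [Finset.sum_congr rfl fun y _ => hta y x, Finset.sum_sub_distrib, Finset.sum_add_distrib,
      hs0, he']
    ring
  have hesum : ∑ x, e x = 0 := by
    rw [Finset.sum_congr rfl fun x _ => he' x, Finset.sum_sub_distrib, Finset.sum_comm]
    ring
  have E1 := tri_sum t (by intro x y; rw [htd]; split_ifs <;> simp)
  have E0 := tri_sum t0 (by intro x y; rw [ht0d]; split_ifs <;> simp)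
  have E : (∑ x, (∑ y, t y x) * (∑ y, t y x) - ∑ x, ∑ y, t y x)
      = (∑ x, (∑ y, t0 y x) * (∑ y, t0 y x) - ∑ x, ∑ y, t0 y x) := by
    simp only [hs, hs0]
    have h1 : ∑ x, ((n:ℤ) - g x + e x) * (n - g x + e x)
        = ∑ x, ((n:ℤ) - g x) * (n - g x) + 2 * n * ∑ x, e x - 2 * ∑ x, e x * (g x : ℤ)
          + ∑ x, e x * e x := by
      simp only [Finset.mul_sum]
      rw [← Finset.sum_add_distrib, ← Finset.sum_sub_distrib, ← Finset.sum_add_distrib]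
      exact Finset.sum_congr rfl fun x _ => by ring
    rw [h1, heq, Finset.sum_add_distrib, hesum]; ring
  have EE := E1.trans ((congrArg (3 * ·) E).trans E0.symm)
  have hle : ∀ x y z, (t y x * t z x * (if y = z then 0 else 1)
      + t z y * t x y * (if z = x then 0 else 1)
      + t x z * t y z * (if x = y then 0 else 1))
      ≤ (t0 y x * t0 z x * (if y = z then 0 else 1)
      + t0 z y * t0 x y * (if z = x then 0 else 1)
      + t0 x z * t0 y z * (if x = y then 0 else 1)) := by
    intro x y z
    have a1 := hTasym x y
    have a2 := hTasym y z
    have a3 := hTasym z x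
    by_cases hxy : x = y
    · subst hxy
      simp [htd, ht0d, hTirr]
    by_cases hyz : y = z
    · subst hyz
      simp [htd, ht0d, hTirr]
    by_cases hzx : z = x
    · subst hzx
      simp [htd, ht0d, hTirr]
    have b1 : g x ≠ g y := fun h => hxy (hg_inj h)
    have b2 : g y ≠ g z := fun h => hyz (hg_inj h)
    have b3 : g z ≠ g x := fun h => hzx (hg_inj h)
    have R : (t0 y x * t0 z x * (if y = z then 0 else 1)
      + t0 z y * t0 x y * (if z = x then 0 else 1)
      + t0 x z * t0 y z * (if x = y then 0 else 1)) = 1 := by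
      simp only [ht0d, hxy, hyz, hzx, if_false]
      split_ifs <;> first | omega | rfl
    rw [R]
    simp only [htd, hxy, hyz, hzx, if_false]
    exact cyc_le _ _ _ _ _ _ a1 a2 a3
  have hpt : ∀ x y z, x ≠ y → y ≠ z → z ≠ x → t y x * t z x + t z y * t x y + t x z * t y z = 1 := by
    have e1 := (Finset.sum_eq_sum_iff_of_le (fun x _ => Finset.sum_le_sum fun y _ =>
      Finset.sum_le_sum fun z _ => hle x y z)).1 EE
    intro x y z hxy hyz hzx
    have e2 := (Finset.sum_eq_sum_iff_of_le (fun y _ =>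
      Finset.sum_le_sum fun z _ => hle x y z)).1 (e1 x (Finset.mem_univ _))
    have e3 := (Finset.sum_eq_sum_iff_of_le (fun z _ => hle x y z)).1
      (e2 y (Finset.mem_univ _)) z (Finset.mem_univ _)
    have b1 : g x ≠ g y := fun h => hxy (hg_inj h)
    have b2 : g y ≠ g z := fun h => hyz (hg_inj h)
    have b3 : g z ≠ g x := fun h => hzx (hg_inj h)
    have R : (t0 y x * t0 z x * (if y = z then 0 else 1)
      + t0 z y * t0 x y * (if z = x then 0 else 1)
      + t0 x z * t0 y z * (if x = y then 0 else 1)) = 1 := by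
      simp only [ht0d, hxy, hyz, hzx, if_false]
      split_ifs <;> first | omega | rfl
    rw [R] at e3
    simpa only [hxy, hyz, hzx, if_false, mul_one] using e3
  have htrans : ∀ x y z, T x y → T y z → T x z := by
    intro x y z h1 h2
    by_contra h3
    have hxy : x ≠ y := by rintro rfl; exact hTirr _ h1
    have hyz : y ≠ z := by rintro rfl; exact hTirr _ h2
    have hzx : z ≠ x := by rintro rfl; exact hTasym _ _ h1 h2
    have := hpt x y z hxy hyz hzx
    simp [htd, h3, hTasym _ _ h1, hTasym _ _ h2] at this
  have hfc : ∀ x, f x = 1 + ((Finset.univ.filter (fun y => T y x)).card : ℤ) := by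
    intro x
    have h1 : ((Finset.univ.filter (fun y => T y x)).card : ℤ) = ∑ y, t y x := by
      simp [htd]
    rw [h1, hs, hf]; ring
  have hmono : ∀ x y, T x y → f x < f y := by
    intro x y h
    rw [hfc, hfc]
    have : (Finset.univ.filter (fun z => T z x)).card < (Finset.univ.filter (fun z => T z y)).card := by
      apply Finset.card_lt_card
      rw [Finset.ssubset_iff_of_subset]
      · exact ⟨x, by simpa using h, by simpa using hTirr x⟩
      · intro z hz
        simp only [Finset.mem_filter, Finset.mem_univ, true_and] at hz ⊢
        exact htrans _ _ _ hz h
    omega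
  refine ⟨?_, ?_, ?_, ?_⟩
  · intro x
    rw [Finset.mem_Icc, hfc]
    have : (Finset.univ.filter (fun z => T z x)).card < n := by
      rw [← hn, ← Finset.card_univ]
      apply Finset.card_lt_card
      rw [Finset.ssubset_iff_of_subset (Finset.subset_univ _)]
      exact ⟨x, Finset.mem_univ _, by simpa using hTirr x⟩
    omega
  · intro x y hxy
    by_contra hne
    rcases hTtot x y hne with h | h
    · have := hmono _ _ h; omega
    · have := hmono _ _ h; omega
  · intro x y h
    exact hmono x y ((hT x y).2 (Or.inl h))
  · intro x y hne
    constructor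
    · intro h
      exact ⟨hmono x y ((hT x y).2 (Or.inl h)), hg_ord x y h⟩
    · rintro ⟨h1, h2⟩
      rcases hTtot x y hne with h | h
      · rcases (hT x y).1 h with h | h
        · exact h
        · omega
      · have := hmono _ _ h; omega
end

section
/- Let D = (V,A) be a digraph on n vertices with e-vector e. If there exists an acyclic ordering g : V → {1,…,n} of D satisfying 2·⟨e,g⟩ = ⟨e,e⟩, then the arc relation A is transitive (so that A is a strict partial order on V, i.e., D is the comparability digraph of a poset). -/
open Finset

/-- sign of the order comparison -/
def sgnT {V : Type*} (g : V → ℕ) (z x : V) : ℤ :=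
  if g z < g x then 1 else if g x < g z then -1 else 0

/-- skew adjacency -/
def skewA {V : Type*} (A : V → V → Prop) [DecidableRel A] (z x : V) : ℤ :=
  (if A z x then 1 else 0) - (if A x z then 1 else 0)

/-- symmetric adjacency -/
def symA {V : Type*} (A : V → V → Prop) [DecidableRel A] (z x : V) : ℤ :=
  if A z x ∨ A x z then 1 else 0

lemma skewA_eq {V : Type*} (A : V → V → Prop) [DecidableRel A] (g : V → ℕ)
    (hg : ∀ x y, A x y → g x < g y) (z x : V) :
    skewA A z x = symA A z x * sgnT g z x := by
  have h1 := hg z x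
  have h2 := hg x z
  unfold skewA symA sgnT
  by_cases a : A z x <;> by_cases b : A x z <;> simp [a, b] <;> simp [a, b] at h1 h2 <;> grind

lemma sgn_sum {V : Type*} [Fintype V] [DecidableEq V] (n : ℕ) (hn : Fintype.card V = n)
    (g : V → ℕ) (hi : Function.Injective g) (hm : ∀ x, g x ∈ Finset.Icc 1 n) (x : V) :
    ∑ z, sgnT g z x = 2 * (g x : ℤ) - (n + 1) := by
  have him : Finset.univ.image g = Finset.Icc 1 n := by
    apply Finset.eq_of_subset_of_card_le
    · intro y hy
      obtain ⟨z, -, rfl⟩ := Finset.mem_image.1 hy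
      exact hm z
    · rw [Finset.card_image_of_injective _ hi]
      simp [hn]
  have hx := Finset.mem_Icc.1 (hm x)
  have c1 : (Finset.univ.filter (fun z => g z < g x)).card = g x - 1 := by
    rw [← Finset.card_image_of_injective _ hi, ← Nat.card_Ico 1 (g x)]
    congr 1
    ext k
    have := Finset.ext_iff.1 him k
    simp at this ⊢
    grind
  have c2 : (Finset.univ.filter (fun z => g x < g z)).card = n - g x := by
    rw [← Finset.card_image_of_injective _ hi, ← Nat.card_Ioc (g x) n]
    congr 1
    ext k
    have := Finset.ext_iff.1 him k
    simp at this ⊢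
    grind
  have : ∀ z, sgnT g z x = (if g z < g x then (1:ℤ) else 0) - (if g x < g z then 1 else 0) := by
    intro z
    unfold sgnT
    grind
  simp only [this, Finset.sum_sub_distrib, Finset.sum_boole, c1, c2]
  omega

/-- contribution of a triple centred at x -/
def tripF {V : Type*} (A : V → V → Prop) [DecidableRel A] (g : V → ℕ) (x z w : V) : ℤ :=
  (symA A z x * sgnT g z x) * ((1 - symA A w x) * sgnT g w x)

/-- symmetrised contribution -/
def tripG {V : Type*} (A : V → V → Prop) [DecidableRel A] (g : V → ℕ) (x z w : V) : ℤ :=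
  tripF A g x z w + tripF A g x w z + tripF A g z x w + tripF A g z w x
    + tripF A g w x z + tripF A g w z x

lemma tripG_nonneg {V : Type*} (A : V → V → Prop) [DecidableRel A] (g : V → ℕ)
    (hi : Function.Injective g) (x z w : V) : 0 ≤ tripG A g x z w := by
  have hs : ∀ a b, symA A a b = symA A b a := by
    intro a b; unfold symA; simp only [or_comm]
  have h01 : ∀ a b, symA A a b = 0 ∨ symA A a b = 1 := by
    intro a b; unfold symA; split_ifs <;> simp
  unfold tripG tripF
  rw [hs z x, hs w x, hs w z]
  by_cases e1 : x = z
  · subst e1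
    have : sgnT g x x = 0 := by simp [sgnT]
    rw [this]
    rcases h01 x w with h | h <;> simp [h]
  by_cases e2 : x = w
  · subst e2
    have : sgnT g x x = 0 := by simp [sgnT]
    rw [this, hs z x]
    rcases h01 x z with h | h <;> simp [h]
  by_cases e3 : z = w
  · subst e3
    have : sgnT g z z = 0 := by simp [sgnT]
    rw [this]
    rcases h01 x z with h | h <;> simp [h]
  have n1 : g x ≠ g z := fun h => e1 (hi h)
  have n2 : g x ≠ g w := fun h => e2 (hi h)
  have n3 : g z ≠ g w := fun h => e3 (hi h)
  unfold sgnT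
  rcases h01 x z with h | h <;> rcases h01 x w with h' | h' <;> rcases h01 z w with h'' | h'' <;>
    rw [h, h', h''] <;> simp <;> split_ifs <;> first | omega | simp

/-- Part of Theorem 2 of the paper: if a digraph admits an acyclic ordering `g`
with `2⟨e,g⟩ = ⟨e,e⟩`, then its arc relation is transitive (so it is the
comparability digraph of a poset). -/
theorem stmt_2 {V : Type*} [Fintype V] [DecidableEq V]
    (A : V → V → Prop) [DecidableRel A]
    (hA : ∀ x y, A x y → x ≠ y)
    (n : ℕ) (hn : Fintype.card V = n)
    (e : V → ℤ)
    (he : ∀ x, e x = ((Finset.univ.filter (fun z => A z x)).card : ℤ)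
                    - ((Finset.univ.filter (fun z => A x z)).card : ℤ))
    (g : V → ℕ)
    (hg_inj : Function.Injective g)
    (hg_mem : ∀ x, g x ∈ Finset.Icc 1 n)
    (hg_ord : ∀ x y, A x y → g x < g y)
    (heq : 2 * ∑ x, e x * (g x : ℤ) = ∑ x, e x * e x) :
    ∀ x y w, A x y → A y w → A x w := by
  have he1 : ∀ x, e x = ∑ z, skewA A z x := by
    intro x
    simp only [he, skewA, Finset.sum_sub_distrib, Finset.sum_boole]
  have he0 : ∑ x, e x = 0 := by
    simp only [he1, skewA, Finset.sum_sub_distrib]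
    rw [Finset.sum_comm, sub_self]
  have hS : ∑ x, ∑ z, ∑ w, tripF A g x z w = 0 := by
    have h1 : ∀ x, ∑ z, ∑ w, tripF A g x z w = e x * ((2 * (g x : ℤ) - (n + 1)) - e x) := by
      intro x
      rw [← sgn_sum n hn g hg_inj hg_mem x, he1, ← Finset.sum_sub_distrib, Finset.sum_mul_sum]
      simp only [tripF, skewA_eq A g hg_ord]
      refine Finset.sum_congr rfl fun z _ => Finset.sum_congr rfl fun w _ => by ring
    have h2 : ∀ x, e x * ((2 * (g x : ℤ) - (n + 1)) - e x)
        = 2 * (e x * (g x : ℤ)) - (n + 1) * e x - e x * e x := by intro x; ring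
    simp only [h1, h2, Finset.sum_sub_distrib, ← Finset.mul_sum]
    rw [he0, heq]; ring
  have hG : ∑ x, ∑ z, ∑ w, tripG A g x z w = 0 := by
    have sw : ∀ F : V → V → V → ℤ, ∑ x, ∑ z, ∑ w, F x w z = ∑ x, ∑ z, ∑ w, F x z w :=
      fun F => Finset.sum_congr rfl fun x _ => Finset.sum_comm
    have sw2 : ∀ F : V → V → V → ℤ, ∑ x, ∑ z, ∑ w, F z x w = ∑ x, ∑ z, ∑ w, F x z w :=
      fun F => Finset.sum_comm
    have b1 := (sw (tripF A g)).trans hS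
    have b2 := (sw2 (tripF A g)).trans hS
    have b3 := (sw2 (fun x z w => tripF A g x w z)).trans b1
    have b4 := (sw (fun x z w => tripF A g z x w)).trans b2
    have b5 := (sw (fun x z w => tripF A g z w x)).trans b3
    simp only [tripG, Finset.sum_add_distrib]
    linarith
  intro x y w hxy hyw
  by_contra hxw
  have nn := tripG_nonneg A g hg_inj
  have z1 := (Finset.sum_eq_zero_iff_of_nonneg (fun x _ => Finset.sum_nonneg fun z _ =>
    Finset.sum_nonneg fun w _ => nn x z w)).1 hG x (Finset.mem_univ _)
  have z2 := (Finset.sum_eq_zero_iff_of_nonneg (fun z _ =>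
    Finset.sum_nonneg fun w _ => nn x z w)).1 z1 y (Finset.mem_univ _)
  have z3 := (Finset.sum_eq_zero_iff_of_nonneg (fun w _ => nn x y w)).1 z2 w (Finset.mem_univ _)
  have l1 := hg_ord _ _ hxy
  have l2 := hg_ord _ _ hyw
  have l3 : g x < g w := l1.trans l2
  have hwx : ¬ A w x := fun h => absurd (hg_ord _ _ h) (by omega)
  simp [tripG, tripF, symA, sgnT, hxy, hyw, hxw, hwx, l1, l2, l3, l1.not_gt, l2.not_gt,
    l3.not_gt] at z3
end

section
/- Let P = (V,<) be a finite strict partially ordered set with n = |V|, and let e(x) = |{z ∈ V : z < x}| − |{z ∈ V : x < z}| be the e-vector of its comparability digraph. Then P has order dimension at most two (i.e., there exist linear extensions f and g of P such that for all x,y: x < y if and only if f(x) < f(y) and g(x) < g(y)) if and only if P has a linear extension g satisfying 2·⟨e,g⟩ = ⟨e,e⟩. -/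
open Finset

/-- number of elements below -/
lemma aux_count {V : Type*} [Fintype V] [DecidableEq V] (n : ℕ) (hn : Fintype.card V = n)
    (g : V → ℕ) (hg : Function.Injective g) (hr : ∀ x, g x ∈ Finset.Icc 1 n) (x : V) :
    2 * (g x : ℤ) = (n : ℤ) + 1 +
      ∑ z, ((if g z < g x then (1 : ℤ) else 0) - (if g x < g z then 1 else 0)) := by
  have him : Finset.univ.image g = Finset.Icc 1 n := by
    apply Finset.eq_of_subset_of_card_le
    · intro y hy
      obtain ⟨z, -, rfl⟩ := Finset.mem_image.1 hy
      exact hr z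
    · rw [Finset.card_image_of_injective _ hg, Finset.card_univ, hn]; simp
  have hx := Finset.mem_Icc.1 (hr x)
  have h1 : (Finset.univ.filter (fun z => g z < g x)).card = g x - 1 := by
    rw [← Finset.card_image_of_injective _ hg]
    have : (Finset.univ.filter (fun z => g z < g x)).image g = Finset.Ico 1 (g x) := by
      ext k
      simp only [Finset.mem_image, Finset.mem_filter, Finset.mem_univ, true_and, Finset.mem_Ico]
      constructor
      · rintro ⟨z, hz, rfl⟩
        exact ⟨(Finset.mem_Icc.1 (hr z)).1, hz⟩
      · rintro ⟨h1, h2⟩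
        have : k ∈ Finset.univ.image g := by rw [him, Finset.mem_Icc]; omega
        obtain ⟨z, -, rfl⟩ := Finset.mem_image.1 this
        exact ⟨z, h2, rfl⟩
    rw [this]; simp
  have h2 : (Finset.univ.filter (fun z => g x < g z)).card = n - g x := by
    rw [← Finset.card_image_of_injective _ hg]
    have : (Finset.univ.filter (fun z => g x < g z)).image g = Finset.Ioc (g x) n := by
      ext k
      simp only [Finset.mem_image, Finset.mem_filter, Finset.mem_univ, true_and, Finset.mem_Ioc]
      constructor
      · rintro ⟨z, hz, rfl⟩
        exact ⟨hz, (Finset.mem_Icc.1 (hr z)).2⟩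
      · rintro ⟨h1, h2⟩
        have : k ∈ Finset.univ.image g := by rw [him, Finset.mem_Icc]; omega
        obtain ⟨z, -, rfl⟩ := Finset.mem_image.1 this
        exact ⟨z, h1, rfl⟩
    rw [this]; simp
  rw [Finset.sum_sub_distrib, Finset.sum_boole, Finset.sum_boole, h1, h2]
  omega

lemma aux_sym {V : Type*} [Fintype V] (F : V → V → V → ℤ) :
    6 * ∑ x, ∑ y, ∑ z, F x y z = ∑ x, ∑ y, ∑ z,
      (F x y z + F x z y + F y x z + F y z x + F z x y + F z y x) := by
  have e1 : ∑ x, ∑ y, ∑ z, F x z y = ∑ x, ∑ y, ∑ z, F x y z :=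
    Finset.sum_congr rfl fun x _ => Finset.sum_comm
  have e2 : ∑ x, ∑ y, ∑ z, F y x z = ∑ x, ∑ y, ∑ z, F x y z := Finset.sum_comm
  have e3 : ∑ x, ∑ y, ∑ z, F y z x = ∑ x, ∑ y, ∑ z, F x y z := by
    rw [Finset.sum_comm]
    exact Finset.sum_congr rfl fun x _ => Finset.sum_comm
  have e4 : ∑ x, ∑ y, ∑ z, F z x y = ∑ x, ∑ y, ∑ z, F x y z := by
    rw [← e2]
    rw [show ∑ x, ∑ y, ∑ z, F z x y = ∑ x, ∑ z, ∑ y, F z x y from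
      Finset.sum_congr rfl fun x _ => Finset.sum_comm]
  have e5 : ∑ x, ∑ y, ∑ z, F z y x = ∑ x, ∑ y, ∑ z, F x y z := by
    rw [← e3]
    rw [show ∑ x, ∑ y, ∑ z, F z y x = ∑ x, ∑ z, ∑ y, F z y x from
      Finset.sum_congr rfl fun x _ => Finset.sum_comm]
  simp only [Finset.sum_add_distrib, e1, e2, e3, e4, e5]
  ring

/-- comparability sign -/
def auxC {V : Type*} (lt : V → V → Prop) [DecidableRel lt] (z x : V) : ℤ :=
  (if lt z x then 1 else 0) - (if lt x z then 1 else 0)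

/-- sign of the linear order -/
def auxS {V : Type*} (g : V → ℕ) (z x : V) : ℤ :=
  (if g z < g x then 1 else 0) - (if g x < g z then 1 else 0)

/-- product term -/
def auxF {V : Type*} (lt : V → V → Prop) [DecidableRel lt] (g : V → ℕ) (x w z : V) : ℤ :=
  auxC lt w x * (auxS g z x - auxC lt z x)

/-- symmetrised term -/
def auxG {V : Type*} (lt : V → V → Prop) [DecidableRel lt] (g : V → ℕ) (x y z : V) : ℤ :=
  auxF lt g x y z + auxF lt g x z y + auxF lt g y x z + auxF lt g y z x
    + auxF lt g z x y + auxF lt g z y x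

/-- separation -/
def auxSep {V : Type*} (lt : V → V → Prop) (g : V → ℕ) (x y z : V) : Prop :=
  g x < g y ∧ g y < g z ∧ lt x z ∧ ¬ lt x y ∧ ¬ lt y z

lemma auxG_eq {V : Type*} (lt : V → V → Prop) [DecidableRel lt] (g : V → ℕ)
    (htrans : ∀ x y z, lt x y → lt y z → lt x z)
    (hl : ∀ x y, lt x y → g x < g y) (x y z : V) (h1 : g x < g y) (h2 : g y < g z) :
    (¬ auxSep lt g x y z → auxG lt g x y z = 0) ∧ (auxSep lt g x y z → auxG lt g x y z = 2) := by
  have h3 := h1.trans h2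
  have n1 : ¬ lt y x := fun h => by have := hl _ _ h; omega
  have n2 : ¬ lt z y := fun h => by have := hl _ _ h; omega
  have n3 : ¬ lt z x := fun h => by have := hl _ _ h; omega
  have t := htrans x y z
  unfold auxSep auxG auxF auxC auxS
  simp only [h1, h2, h3, n1, n2, n3, h1.not_gt, h2.not_gt, h3.not_gt, if_true, if_false]
  by_cases a : lt x y <;> by_cases b : lt y z <;> by_cases c : lt x z <;> simp_all

lemma auxG_perm1 {V : Type*} (lt : V → V → Prop) [DecidableRel lt] (g : V → ℕ) (x y z : V) :
    auxG lt g x y z = auxG lt g y x z := by unfold auxG; ring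

lemma auxG_perm2 {V : Type*} (lt : V → V → Prop) [DecidableRel lt] (g : V → ℕ) (x y z : V) :
    auxG lt g x y z = auxG lt g x z y := by unfold auxG; ring

lemma auxG_diag {V : Type*} (lt : V → V → Prop) [DecidableRel lt] (g : V → ℕ)
    (hirr : ∀ x, ¬ lt x x) (hl : ∀ x y, lt x y → g x < g y) (x z : V) :
    auxG lt g x x z = 0 := by
  have hxz := hl x z
  have hzx := hl z x
  have hi := hirr x
  unfold auxG auxF auxC auxS
  by_cases a : lt x z
  · have h1 := hxz a
    have h2 : ¬ lt z x := fun b => by have := hzx b; omega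
    simp [a, h1, h2, hi, h1.not_gt]
  · by_cases b : lt z x
    · have h1 := hzx b
      simp [a, b, h1, hi, h1.not_gt]
    · simp [a, b, hi]

lemma auxG_cases {V : Type*} (lt : V → V → Prop) [DecidableRel lt] (g : V → ℕ)
    (hg : Function.Injective g) (hirr : ∀ x, ¬ lt x x)
    (htrans : ∀ x y z, lt x y → lt y z → lt x z)
    (hl : ∀ x y, lt x y → g x < g y) (x y z : V) :
    0 ≤ auxG lt g x y z ∧ ((∀ a b c, ¬ auxSep lt g a b c) → auxG lt g x y z = 0) := by
  have key : ∀ x y z, g x < g y → g y < g z →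
      0 ≤ auxG lt g x y z ∧ ((∀ a b c, ¬ auxSep lt g a b c) → auxG lt g x y z = 0) := by
    intro x y z h1 h2
    obtain ⟨k1, k2⟩ := auxG_eq lt g htrans hl x y z h1 h2
    refine ⟨?_, fun h => k1 (h _ _ _)⟩
    by_cases s : auxSep lt g x y z
    · rw [k2 s]; norm_num
    · rw [k1 s]
  have key0 : ∀ x z, 0 ≤ auxG lt g x x z ∧
      ((∀ a b c, ¬ auxSep lt g a b c) → auxG lt g x x z = 0) := by
    intro x z
    rw [auxG_diag lt g hirr hl]; simp
  have p1 := auxG_perm1 lt g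
  have p2 := auxG_perm2 lt g
  rcases lt_trichotomy (g x) (g y) with h | h | h
  · rcases lt_trichotomy (g y) (g z) with h' | h' | h'
    · exact key _ _ _ h h'
    · obtain rfl := hg h'
      rw [p1, p2]; exact key0 _ _
    · rcases lt_trichotomy (g x) (g z) with h'' | h'' | h''
      · rw [p2]; exact key _ _ _ h'' h'
      · obtain rfl := hg h''
        rw [p2]; exact key0 _ _
      · rw [p2, p1]; exact key _ _ _ h'' h
  · obtain rfl := hg h
    exact key0 _ _
  · rcases lt_trichotomy (g x) (g z) with h' | h' | h'
    · rw [p1]; exact key _ _ _ h h'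
    · obtain rfl := hg h'
      rw [p2]; exact key0 _ _
    · rcases lt_trichotomy (g y) (g z) with h'' | h'' | h''
      · rw [p1, p2]; exact key _ _ _ h'' h'
      · obtain rfl := hg h''
        rw [p1, p2]; exact key0 _ _
      · rw [p1, p2, p1]; exact key _ _ _ h'' h

lemma aux_main {V : Type*} [Fintype V] [DecidableEq V]
    (lt : V → V → Prop) [DecidableRel lt]
    (hirr : ∀ x, ¬ lt x x)
    (htrans : ∀ x y z, lt x y → lt y z → lt x z)
    (n : ℕ) (hn : Fintype.card V = n)
    (e : V → ℤ)
    (he : ∀ x, e x = ((Finset.univ.filter (fun z => lt z x)).card : ℤ)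
                    - ((Finset.univ.filter (fun z => lt x z)).card : ℤ))
    (g : V → ℕ) (hg : Function.Injective g) (hr : ∀ x, g x ∈ Finset.Icc 1 n)
    (hl : ∀ x y, lt x y → g x < g y) :
    2 * ∑ x, e x * (g x : ℤ) = ∑ x, e x * e x ↔ ∀ a b c, ¬ auxSep lt g a b c := by
  have he' : ∀ x, e x = ∑ z, auxC lt z x := by
    intro x
    rw [he]; unfold auxC
    rw [Finset.sum_sub_distrib, Finset.sum_boole, Finset.sum_boole]
  have hs0 : ∑ x, e x = 0 := by
    have h1 : ∑ x, e x = ∑ x, ∑ z, auxC lt z x := Finset.sum_congr rfl fun x _ => he' x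
    have h2 : ∑ x, ∑ z, auxC lt z x = - ∑ x, ∑ z, auxC lt z x := by
      conv_lhs => rw [Finset.sum_comm]
      rw [← Finset.sum_neg_distrib]
      refine Finset.sum_congr rfl fun x _ => ?_
      rw [← Finset.sum_neg_distrib]
      refine Finset.sum_congr rfl fun z _ => ?_
      unfold auxC; ring
    omega
  have h1 : 2 * ∑ x, e x * (g x : ℤ) = ∑ x, e x * e x + ∑ x, ∑ w, ∑ z, auxF lt g x w z := by
    have : ∀ x, 2 * (e x * (g x : ℤ)) =
        e x * ((n : ℤ) + 1) + e x * e x + ∑ w, ∑ z, auxF lt g x w z := by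
      intro x
      have h2 := aux_count n hn g hg hr x
      have h3 : ∑ w, ∑ z, auxF lt g x w z = e x * (∑ z, auxS g z x - e x) := by
        unfold auxF
        rw [← Finset.sum_mul_sum, Finset.sum_sub_distrib, ← he']
      have h4 : 2 * (g x : ℤ) = (n : ℤ) + 1 + ∑ z, auxS g z x := h2
      rw [h3]
      linear_combination e x * h4
    rw [Finset.mul_sum, Finset.sum_congr rfl fun x _ => this x]
    rw [Finset.sum_add_distrib, Finset.sum_add_distrib, ← Finset.sum_mul, hs0]
    ring
  have h6 : 6 * ∑ x, ∑ w, ∑ z, auxF lt g x w z = ∑ x, ∑ y, ∑ z, auxG lt g x y z := aux_sym _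
  have hc := auxG_cases lt g hg hirr htrans hl
  constructor
  · intro h a b c hs
    have h0 : ∑ x, ∑ y, ∑ z, auxG lt g x y z = 0 := by omega
    have i1 := (Finset.sum_eq_zero_iff_of_nonneg (fun x _ => Finset.sum_nonneg fun y _ =>
      Finset.sum_nonneg fun z _ => (hc x y z).1)).1 h0 a (Finset.mem_univ _)
    have i2 := (Finset.sum_eq_zero_iff_of_nonneg (fun y _ =>
      Finset.sum_nonneg fun z _ => (hc a y z).1)).1 i1 b (Finset.mem_univ _)
    have i3 := (Finset.sum_eq_zero_iff_of_nonneg (fun z _ => (hc a b z).1)).1 i2 c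
      (Finset.mem_univ _)
    have := (auxG_eq lt g htrans hl a b c hs.1 hs.2.1).2 hs
    omega
  · intro h
    have h0 : ∑ x, ∑ y, ∑ z, auxG lt g x y z = 0 :=
      Finset.sum_eq_zero fun x _ => Finset.sum_eq_zero fun y _ =>
        Finset.sum_eq_zero fun z _ => (hc x y z).2 h
    omega

/-- rank function of a strict total order -/
lemma aux_rank {V : Type*} [Fintype V] [DecidableEq V] (n : ℕ) (hn : Fintype.card V = n)
    (r : V → V → Prop) (ir : ∀ x, ¬ r x x) (tr : ∀ x y z, r x y → r y z → r x z)
    (tot : ∀ x y, x ≠ y → r x y ∨ r y x) :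
    ∃ f : V → ℕ, Function.Injective f ∧ (∀ x, f x ∈ Finset.Icc 1 n) ∧
      ∀ x y, f x < f y ↔ r x y := by
  classical
  have mono : ∀ x y, r x y → (Finset.univ.filter (fun z => r z x)).card + 1 <
      (Finset.univ.filter (fun z => r z y)).card + 1 := by
    intro x y h
    apply Nat.succ_lt_succ
    apply Finset.card_lt_card
    rw [Finset.ssubset_iff_of_subset]
    · exact ⟨x, by simpa using h, by simpa using ir x⟩
    · intro z hz
      simp only [Finset.mem_filter, Finset.mem_univ, true_and] at hz ⊢
      exact tr _ _ _ hz h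
  refine ⟨fun x => (Finset.univ.filter (fun z => r z x)).card + 1, ?_, ?_, ?_⟩
  · intro x y h
    by_contra hne
    dsimp only at h
    rcases tot x y hne with k | k
    · have := mono _ _ k; omega
    · have := mono _ _ k; omega
  · intro x
    rw [Finset.mem_Icc]
    refine ⟨Nat.succ_pos _, ?_⟩
    have : (Finset.univ.filter (fun z => r z x)).card < (Finset.univ : Finset V).card := by
      apply Finset.card_lt_card
      rw [Finset.ssubset_iff_of_subset (Finset.filter_subset _ _)]
      exact ⟨x, Finset.mem_univ _, by simpa using ir x⟩
    rw [Finset.card_univ, hn] at this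
    exact this
  · intro x y
    refine ⟨fun h => ?_, mono x y⟩
    by_contra hn'
    by_cases hxy : x = y
    · subst hxy; exact lt_irrefl _ h
    · have := mono _ _ ((tot x y hxy).resolve_left hn')
      dsimp only at h
      omega

/-- Corollary (Bier): a finite poset has order dimension at most two if and only if
it has a linear extension `g` satisfying `2⟨e,g⟩ = ⟨e,e⟩`. -/
theorem stmt_3 {V : Type*} [Fintype V] [DecidableEq V]
    (lt : V → V → Prop) [DecidableRel lt]
    (hirr : ∀ x, ¬ lt x x)
    (htrans : ∀ x y z, lt x y → lt y z → lt x z)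
    (n : ℕ) (hn : Fintype.card V = n)
    (e : V → ℤ)
    (he : ∀ x, e x = ((Finset.univ.filter (fun z => lt z x)).card : ℤ)
                    - ((Finset.univ.filter (fun z => lt x z)).card : ℤ)) :
    (∃ f g : V → ℕ,
      Function.Injective f ∧ (∀ x, f x ∈ Finset.Icc 1 n) ∧
      (∀ x y, lt x y → f x < f y) ∧
      Function.Injective g ∧ (∀ x, g x ∈ Finset.Icc 1 n) ∧
      (∀ x y, lt x y → g x < g y) ∧
      (∀ x y, lt x y ↔ f x < f y ∧ g x < g y)) ↔
    (∃ g : V → ℕ,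
      Function.Injective g ∧ (∀ x, g x ∈ Finset.Icc 1 n) ∧
      (∀ x y, lt x y → g x < g y) ∧
      2 * ∑ x, e x * (g x : ℤ) = ∑ x, e x * e x) := by
  constructor
  · rintro ⟨f, g, hf, hfr, hfl, hg, hgr, hgl, hfg⟩
    refine ⟨g, hg, hgr, hgl, ?_⟩
    rw [aux_main lt hirr htrans n hn e he g hg hgr hgl]
    rintro a b c ⟨h1, h2, h3, h4, h5⟩
    rw [hfg] at h3 h4 h5
    omega
  · rintro ⟨g, hg, hgr, hgl, h⟩
    rw [aux_main lt hirr htrans n hn e he g hg hgr hgl] at h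
    unfold auxSep at h
    obtain ⟨f, hf, hfr, hfr'⟩ := aux_rank n hn
      (fun x y => lt x y ∨ (¬ lt x y ∧ ¬ lt y x ∧ g y < g x))
      (by intro x; simp [hirr])
      (by
        intro x y z hxy hyz
        have a1 := hgl x y
        have a2 := hgl y z
        have a3 := hgl x z
        have a4 := hgl z x
        have b1 := htrans x y z
        have b2 := htrans z x y
        have b3 := htrans y z x
        have c1 := h x z y
        have c2 := h y x z
        have c3 := h z y x
        have d : g x = g z → x = z := fun k => hg k
        by_cases hxz : x = z
        · subst hxz; exfalso; grind
        · have : g x ≠ g z := fun k => hxz (d k)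
          grind)
      (by
        intro x y hne
        have : g x ≠ g y := fun k => hne (hg k)
        have a1 := hgl x y
        have a2 := hgl y x
        grind)
    refine ⟨f, g, hf, hfr, fun x y hxy => (hfr' x y).2 (Or.inl hxy), hg, hgr, hgl, ?_⟩
    intro x y
    rw [hfr']
    have := hgl x y
    constructor
    · intro k; exact ⟨Or.inl k, this k⟩
    · rintro ⟨k | k, k'⟩
      · exact k
      · omega
end

section
/- Let P = (V,<) be a finite strict partially ordered set with n = |V|, and suppose f and g are linear extensions of P realizing P as their intersection, i.e., for all x,y ∈ V: x < y if and only if f(x) < f(y) and g(x) < g(y). Then f(x) + g(x) = n + 1 + e(x) for every x ∈ V, where e(x) = |{z ∈ V : z < x}| − |{z ∈ V : x < z}|. -/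
open Finset

/-- In a bijective numbering, the label of `x` is one more than the number of smaller labels. -/
theorem label_eq_card {V : Type*} [Fintype V] (f : V → ℕ) (n : ℕ) (hn : Fintype.card V = n)
    (hinj : Function.Injective f) (hmem : ∀ x, f x ∈ Finset.Icc 1 n) (x : V) :
    (Finset.univ.filter (fun z => f z < f x)).card + 1 = f x := by
  classical
  have himg : Finset.univ.image f = Finset.Icc 1 n := by
    apply Finset.eq_of_subset_of_card_le
    · intro a ha
      obtain ⟨z, -, rfl⟩ := Finset.mem_image.1 ha
      exact hmem z
    · rw [Finset.card_image_of_injective _ hinj, Finset.card_univ, hn]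
      simp
  have hx := Finset.mem_Icc.1 (hmem x)
  have h2 : (Finset.univ.filter (fun z => f z < f x)).image f = Finset.Ico 1 (f x) := by
    ext a
    simp only [Finset.mem_image, Finset.mem_filter, Finset.mem_univ, true_and, Finset.mem_Ico]
    constructor
    · rintro ⟨z, hz, rfl⟩
      exact ⟨(Finset.mem_Icc.1 (hmem z)).1, hz⟩
    · rintro ⟨h1, h3⟩
      have : a ∈ Finset.univ.image f := by
        rw [himg, Finset.mem_Icc]
        omega
      obtain ⟨z, -, rfl⟩ := Finset.mem_image.1 this
      exact ⟨z, h3, rfl⟩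
  have h3 := congrArg Finset.card h2
  rw [Finset.card_image_of_injective _ hinj, Nat.card_Ico] at h3
  omega

/-- If linear extensions `f` and `g` realize the poset `P` as their intersection,
then `f + g = n + 1 + e` pointwise. -/
theorem stmt_4 {V : Type*} [Fintype V] [DecidableEq V]
    (lt : V → V → Prop) [DecidableRel lt]
    (hirr : ∀ x, ¬ lt x x)
    (htrans : ∀ x y z, lt x y → lt y z → lt x z)
    (n : ℕ) (hn : Fintype.card V = n)
    (e : V → ℤ)
    (he : ∀ x, e x = ((Finset.univ.filter (fun z => lt z x)).card : ℤ)
                    - ((Finset.univ.filter (fun z => lt x z)).card : ℤ))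
    (f g : V → ℕ)
    (hf_inj : Function.Injective f) (hf_mem : ∀ x, f x ∈ Finset.Icc 1 n)
    (hf_ord : ∀ x y, lt x y → f x < f y)
    (hg_inj : Function.Injective g) (hg_mem : ∀ x, g x ∈ Finset.Icc 1 n)
    (hg_ord : ∀ x y, lt x y → g x < g y)
    (hint : ∀ x y, lt x y ↔ f x < f y ∧ g x < g y) :
    ∀ x, (f x : ℤ) + (g x : ℤ) = (n : ℤ) + 1 + e x := by
  intro x
  have hf := label_eq_card f n hn hf_inj hf_mem x
  have hg := label_eq_card g n hn hg_inj hg_mem x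
  have key : (Finset.univ.filter (fun z => f z < f x)).card
      + (Finset.univ.filter (fun z => g z < g x)).card
      + (Finset.univ.filter (fun z => lt x z)).card
      + (Finset.univ.filter (fun z => z = x)).card
      = (Finset.univ : Finset V).card + (Finset.univ.filter (fun z => lt z x)).card := by
    rw [Finset.card_eq_sum_ones (Finset.univ : Finset V)]
    simp only [Finset.card_filter]
    simp only [← Finset.sum_add_distrib]
    apply Finset.sum_congr rfl
    intro z _
    simp only [hint]
    by_cases hzx : z = x
    · subst hzx
      simp
    · have h1 : f z ≠ f x := fun h => hzx (hf_inj h)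
      have h2 : g z ≠ g x := fun h => hzx (hg_inj h)
      rw [if_neg hzx]
      split_ifs <;> omega
  have h1 : (Finset.univ.filter (fun z => z = x)).card = 1 := by
    rw [Finset.card_eq_one]
    refine ⟨x, ?_⟩
    ext z
    simp only [Finset.mem_filter, Finset.mem_univ, true_and, Finset.mem_singleton]
  rw [h1, Finset.card_univ, hn] at key
  rw [he]
  omega
end

section
/- Let P = (V,<) be a finite strict partially ordered set with n = |V|, and suppose f and g are linear extensions of P realizing P as their intersection, i.e., for all x,y ∈ V: x < y if and only if f(x) < f(y) and g(x) < g(y). Then 2·⟨e,g⟩ = ⟨e,e⟩ and 2·⟨e,f⟩ = ⟨e,e⟩, where e(x) = |{z ∈ V : z < x}| − |{z ∈ V : x < z}|. -/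
open Finset

theorem sum_ext_aux {V : Type*} [Fintype V] (n : ℕ) (hn : Fintype.card V = n) (f : V → ℕ)
    (hf_inj : Function.Injective f) (hf_mem : ∀ x, f x ∈ Finset.Icc 1 n) (φ : ℕ → ℤ) :
    ∑ x, φ (f x) = ∑ k ∈ Finset.Icc 1 n, φ k := by
  classical
  have h : Finset.univ.image f = Finset.Icc 1 n := by
    apply Finset.eq_of_subset_of_card_le
    · intro k hk
      obtain ⟨x, -, rfl⟩ := Finset.mem_image.1 hk
      exact hf_mem x
    · rw [Finset.card_image_of_injective _ hf_inj, Finset.card_univ, hn]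
      simp
  rw [← h, Finset.sum_image (fun a _ b _ hab => hf_inj hab)]

theorem sgn_aux {V : Type*} [Fintype V] (n : ℕ) (hn : Fintype.card V = n) (f : V → ℕ)
    (hf_inj : Function.Injective f) (hf_mem : ∀ x, f x ∈ Finset.Icc 1 n) (x : V) :
    ∑ z, ((if f z < f x then (1 : ℤ) else 0) - (if f x < f z then (1 : ℤ) else 0))
      = 2 * (f x : ℤ) - (n + 1) := by
  have h := sum_ext_aux n hn f hf_inj hf_mem
    (fun k => (if k < f x then (1 : ℤ) else 0) - (if f x < k then (1 : ℤ) else 0))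
  rw [h, Finset.sum_sub_distrib, Finset.sum_boole, Finset.sum_boole]
  have hm := Finset.mem_Icc.1 (hf_mem x)
  have h1 : (Finset.Icc 1 n).filter (fun k => k < f x) = Finset.Ico 1 (f x) := by
    ext k; simp only [Finset.mem_filter, Finset.mem_Icc, Finset.mem_Ico]; omega
  have h2 : (Finset.Icc 1 n).filter (fun k => f x < k) = Finset.Ioc (f x) n := by
    ext k; simp only [Finset.mem_filter, Finset.mem_Icc, Finset.mem_Ioc]; omega
  rw [h1, h2, Nat.card_Ico, Nat.card_Ioc]
  omega

theorem sq_aux {V : Type*} [Fintype V] (n : ℕ) (hn : Fintype.card V = n) (f g : V → ℕ)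
    (hf_inj : Function.Injective f) (hf_mem : ∀ x, f x ∈ Finset.Icc 1 n)
    (hg_inj : Function.Injective g) (hg_mem : ∀ x, g x ∈ Finset.Icc 1 n) :
    ∑ x, (g x : ℤ) ^ 2 = ∑ x, ((n : ℤ) + 1 - f x) ^ 2 := by
  rw [sum_ext_aux n hn g hg_inj hg_mem (fun k => (k : ℤ) ^ 2),
    sum_ext_aux n hn f hf_inj hf_mem (fun k => ((n : ℤ) + 1 - k) ^ 2)]
  refine Finset.sum_bij' (fun k _ => n + 1 - k) (fun k _ => n + 1 - k) ?_ ?_ ?_ ?_ ?_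
  · intro k hk; simp only [Finset.mem_Icc] at *; omega
  · intro k hk; simp only [Finset.mem_Icc] at *; omega
  · intro k hk; simp only [Finset.mem_Icc] at *; omega
  · intro k hk; simp only [Finset.mem_Icc] at *; omega
  · intro k hk
    simp only [Finset.mem_Icc] at hk
    congr 1
    omega

/-- If linear extensions `f` and `g` realize the poset `P` as their intersection,
then both attain the equality `2⟨e,g⟩ = ⟨e,e⟩` and `2⟨e,f⟩ = ⟨e,e⟩`. -/
theorem stmt_5 {V : Type*} [Fintype V] [DecidableEq V]
    (lt : V → V → Prop) [DecidableRel lt]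
    (hirr : ∀ x, ¬ lt x x)
    (htrans : ∀ x y z, lt x y → lt y z → lt x z)
    (n : ℕ) (hn : Fintype.card V = n)
    (e : V → ℤ)
    (he : ∀ x, e x = ((Finset.univ.filter (fun z => lt z x)).card : ℤ)
                    - ((Finset.univ.filter (fun z => lt x z)).card : ℤ))
    (f g : V → ℕ)
    (hf_inj : Function.Injective f) (hf_mem : ∀ x, f x ∈ Finset.Icc 1 n)
    (hf_ord : ∀ x y, lt x y → f x < f y)
    (hg_inj : Function.Injective g) (hg_mem : ∀ x, g x ∈ Finset.Icc 1 n)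
    (hg_ord : ∀ x y, lt x y → g x < g y)
    (hint : ∀ x y, lt x y ↔ f x < f y ∧ g x < g y) :
    2 * ∑ x, e x * (g x : ℤ) = ∑ x, e x * e x ∧
    2 * ∑ x, e x * (f x : ℤ) = ∑ x, e x * e x := by
  have key : ∀ x, e x = f x + g x - (n + 1) := by
    intro x
    have h1 := sgn_aux n hn f hf_inj hf_mem x
    have h2 := sgn_aux n hn g hg_inj hg_mem x
    have h3 : e x = ∑ z, ((if lt z x then (1 : ℤ) else 0) - (if lt x z then (1 : ℤ) else 0)) := by
      rw [he, Finset.sum_sub_distrib, Finset.sum_boole, Finset.sum_boole]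
    have h4 : 2 * e x = (2 * (f x : ℤ) - (n + 1)) + (2 * (g x : ℤ) - (n + 1)) := by
      rw [← h1, ← h2, h3, Finset.mul_sum, ← Finset.sum_add_distrib]
      refine Finset.sum_congr rfl fun z _ => ?_
      by_cases hz : z = x
      · subst hz; simp [hirr]
      · have a1 : f z ≠ f x := fun h => hz (hf_inj h)
        have a2 : g z ≠ g x := fun h => hz (hg_inj h)
        simp only [hint]
        split_ifs <;> omega
    linarith
  have fin : ∀ f g : V → ℕ, (∀ x, e x = f x + g x - (n + 1)) →
      ∑ x, (g x : ℤ) ^ 2 = ∑ x, ((n : ℤ) + 1 - f x) ^ 2 →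
      2 * ∑ x, e x * (g x : ℤ) = ∑ x, e x * e x := by
    intro f g hk hs
    have h0 : 2 * ∑ x, e x * (g x : ℤ) - ∑ x, e x * e x
        = ∑ x, (g x : ℤ) ^ 2 - ∑ x, ((n : ℤ) + 1 - f x) ^ 2 := by
      rw [Finset.mul_sum, ← Finset.sum_sub_distrib, ← Finset.sum_sub_distrib]
      refine Finset.sum_congr rfl fun x _ => ?_
      rw [hk]; ring
    linarith
  exact ⟨fin f g key (sq_aux n hn f g hf_inj hf_mem hg_inj hg_mem),
    fin g f (fun x => by rw [key]; ring) (sq_aux n hn g f hg_inj hg_mem hf_inj hf_mem)⟩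
end

section
/- Let D = (V,A) be a digraph on n vertices with e-vector e, let g : V → {1,…,n} be an acyclic ordering of D, let z ∈ V be a maximal element of D (i.e., N⁺(z) = ∅), and let m = |N⁻(z)|. Then Σ_{x∈N⁻(z)} (e(x) − g(x)) + n·m ≥ m(m−1)/2. -/
open Finset

/-- Lemma 1 of the paper: for an acyclic ordering `g` of a digraph `D` and a
maximal element `z` with in-degree `m`, we have
`Σ_{x∈N⁻(z)} (e(x) − g(x)) + n·m ≥ m(m−1)/2`. -/
theorem stmt_7 {V : Type*} [Fintype V] [DecidableEq V]
    (A : V → V → Prop) [DecidableRel A]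
    (hA : ∀ x y, A x y → x ≠ y)
    (n : ℕ) (hn : Fintype.card V = n)
    (e : V → ℤ)
    (he : ∀ x, e x = ((Finset.univ.filter (fun z => A z x)).card : ℤ)
                    - ((Finset.univ.filter (fun z => A x z)).card : ℤ))
    (g : V → ℕ)
    (hg_inj : Function.Injective g)
    (hg_mem : ∀ x, g x ∈ Finset.Icc 1 n)
    (hg_ord : ∀ x y, A x y → g x < g y)
    (z : V) (hz_max : ∀ y, ¬ A z y)
    (m : ℕ) (hm : m = (Finset.univ.filter (fun x => A x z)).card) :
    (∑ x ∈ Finset.univ.filter (fun x => A x z), (e x - (g x : ℤ))) + (n : ℤ) * m ≥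
      (m : ℤ) * ((m : ℤ) - 1) / 2 := by
  classical
  set S := Finset.univ.filter (fun x => A x z) with hS
  -- vertices after `x` inject into the interval above `g x`
  have hafter : ∀ x, ((univ.filter (fun y => g x < g y)).card : ℤ) ≤ n - g x := by
    intro x
    have h1 : (univ.filter (fun y => g x < g y)).card ≤ (Finset.Ioc (g x) n).card := by
      refine Finset.card_le_card_of_injOn g ?_ hg_inj.injOn
      intro y hy
      have hy2 : g x < g y := by simpa using hy
      have := Finset.mem_Icc.1 (hg_mem y)
      simp only [Finset.coe_Ioc, Set.mem_Ioc]
      exact ⟨hy2, this.2⟩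
    rw [Nat.card_Ioc] at h1
    have := Finset.mem_Icc.1 (hg_mem x)
    omega
  have hpt : ∀ x ∈ S, ((S.filter (fun y => A y x)).card : ℤ)
      + (S.filter (fun y => g x < g y)).card - (S.filter (fun y => A x y)).card
      ≤ e x - g x + n := by
    intro x _
    have h1 : (S.filter (fun y => A y x)).card ≤ (univ.filter (fun y => A y x)).card :=
      Finset.card_le_card (Finset.filter_subset_filter _ (Finset.subset_univ _))
    have h2 : (S.filter (fun y => g x < g y)).card + (univ.filter (fun y => A x y)).card
        ≤ (univ.filter (fun y => g x < g y)).card + (S.filter (fun y => A x y)).card := by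
      rw [← Finset.card_union_add_card_inter]
      refine Nat.add_le_add (Finset.card_le_card ?_) (Finset.card_le_card ?_)
      · intro y hy
        simp only [Finset.mem_union, Finset.mem_filter, Finset.mem_univ, true_and] at hy ⊢
        rcases hy with hy | hy
        · exact hy.2
        · exact hg_ord _ _ hy
      · intro y hy
        simp only [Finset.mem_inter, Finset.mem_filter, Finset.mem_univ, true_and] at hy ⊢
        exact ⟨hy.1.1, hy.2⟩
    have h3 := hafter x
    rw [he x]
    omega
  have hsum := Finset.sum_le_sum hpt
  have hcomm : ∑ x ∈ S, ((S.filter (fun y => A y x)).card : ℤ)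
      = ∑ x ∈ S, ((S.filter (fun y => A x y)).card : ℤ) := by
    simp only [Finset.card_filter, Nat.cast_sum]
    rw [Finset.sum_comm]
  have hcomm2 : ∑ x ∈ S, ((S.filter (fun y => g y < g x)).card : ℤ)
      = ∑ x ∈ S, ((S.filter (fun y => g x < g y)).card : ℤ) := by
    simp only [Finset.card_filter, Nat.cast_sum]
    rw [Finset.sum_comm]
  have htot : ∑ x ∈ S, (((S.filter (fun y => g y < g x)).card : ℤ)
      + (S.filter (fun y => g x < g y)).card) = m * (m - 1) := by
    have : ∀ x ∈ S, (((S.filter (fun y => g y < g x)).card : ℤ)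
      + (S.filter (fun y => g x < g y)).card) = (m : ℤ) - 1 := by
      intro x hx
      have h1 : (S.filter (fun y => g y < g x)).card + (S.filter (fun y => g x < g y)).card
          = (S.erase x).card := by
        rw [← Finset.card_union_of_disjoint]
        · congr 1
          ext y
          simp only [Finset.mem_union, Finset.mem_filter, Finset.mem_erase]
          have : y ≠ x ↔ g y ≠ g x := hg_inj.ne_iff.symm
          rw [this, ← and_or_left, ← ne_iff_lt_or_gt, and_comm]
        · rw [Finset.disjoint_filter]
          intro y _ h
          omega
      have h2 := Finset.card_erase_add_one hx
      omega
    rw [Finset.sum_congr rfl this, Finset.sum_const, ← hm, nsmul_eq_mul]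
  rw [Finset.sum_add_distrib, hcomm2] at htot
  rw [Finset.sum_sub_distrib, Finset.sum_add_distrib, hcomm, Finset.sum_add_distrib,
    Finset.sum_const, ← hm, nsmul_eq_mul, mul_comm (m : ℤ) n] at hsum
  rw [← htot]
  omega
end

section
/- Let D = (V,A) be a digraph on n vertices with e-vector e, let g : V → {1,…,n} be an acyclic ordering of D, and let W ⊆ V. Then −Σ_{x∈W} e(x) is at most the number of insertion pairs of the set S = g(W) = {g(x) : x ∈ W} ⊆ {1,…,n}, i.e., Σ_{x∈W} e(x) ≥ −|{(s,t) : s ∈ S, t ∈ {1,…,n} \ S, s < t}|. -/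
open Finset

/-- For an acyclic ordering `g` of a digraph `D` and any set `W` of vertices,
`−Σ_{x∈W} e(x)` is at most the number of insertion pairs of `S = g(W) ⊆ {1,…,n}`. -/
theorem stmt_9 {V : Type*} [Fintype V] [DecidableEq V]
    (A : V → V → Prop) [DecidableRel A]
    (hA : ∀ x y, A x y → x ≠ y)
    (n : ℕ) (hn : Fintype.card V = n)
    (e : V → ℤ)
    (he : ∀ x, e x = ((Finset.univ.filter (fun z => A z x)).card : ℤ)
                    - ((Finset.univ.filter (fun z => A x z)).card : ℤ))
    (g : V → ℕ)
    (hg_inj : Function.Injective g)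
    (hg_mem : ∀ x, g x ∈ Finset.Icc 1 n)
    (hg_ord : ∀ x y, A x y → g x < g y)
    (W : Finset V) (S : Finset ℕ) (hSdef : S = W.image g) :
    (∑ x ∈ W, e x) ≥
      -((((S ×ˢ (Finset.Icc 1 n \ S)).filter (fun p => p.1 < p.2)).card : ℤ)) := by
  have hcard : ((W ×ˢ Wᶜ).filter (fun p => A p.1 p.2)).card ≤
      ((S ×ˢ (Finset.Icc 1 n \ S)).filter (fun p => p.1 < p.2)).card := by
    apply Finset.card_le_card_of_injOn (fun p => (g p.1, g p.2))
    · rintro ⟨x, y⟩ hp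
      simp only [Finset.coe_filter, Finset.mem_product, Finset.mem_compl, Set.mem_setOf_eq] at hp
      obtain ⟨⟨hx, hy⟩, hxy⟩ := hp
      simp only [Finset.coe_filter, Finset.mem_product, Finset.mem_sdiff, Set.mem_setOf_eq, hSdef]
      refine ⟨⟨Finset.mem_image_of_mem g hx, hg_mem y, ?_⟩, hg_ord x y hxy⟩
      rw [Finset.mem_image]
      rintro ⟨z, hz, hzy⟩
      exact hy (hg_inj hzy ▸ hz)
    · rintro ⟨x, y⟩ _ ⟨x', y'⟩ _ h
      simp only [Prod.mk.injEq] at h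
      exact Prod.ext (hg_inj h.1) (hg_inj h.2)
  have hcard' : (((W ×ˢ Wᶜ).filter (fun p => A p.1 p.2)).card : ℤ) =
      ∑ x ∈ W, ∑ z ∈ Wᶜ, (if A x z then (1 : ℤ) else 0) := by
    rw [← Finset.sum_product' W Wᶜ (fun x z => if A x z then (1 : ℤ) else 0), Finset.sum_boole]
  have h1 : ∑ x ∈ W, e x =
      (∑ x ∈ W, ∑ z ∈ W, (if A z x then (1 : ℤ) else 0)
        + ∑ x ∈ W, ∑ z ∈ Wᶜ, (if A z x then (1 : ℤ) else 0))
      - (∑ x ∈ W, ∑ z ∈ W, (if A x z then (1 : ℤ) else 0)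
        + ∑ x ∈ W, ∑ z ∈ Wᶜ, (if A x z then (1 : ℤ) else 0)) := by
    rw [← Finset.sum_add_distrib, ← Finset.sum_add_distrib, ← Finset.sum_sub_distrib]
    refine Finset.sum_congr rfl fun x _ => ?_
    rw [Finset.sum_add_sum_compl, Finset.sum_add_sum_compl, Finset.sum_boole, Finset.sum_boole, he]
  have h2 : ∑ x ∈ W, ∑ z ∈ W, (if A z x then (1 : ℤ) else 0) =
      ∑ x ∈ W, ∑ z ∈ W, (if A x z then (1 : ℤ) else 0) := Finset.sum_comm
  have h3 : 0 ≤ ∑ x ∈ W, ∑ z ∈ Wᶜ, (if A z x then (1 : ℤ) else 0) :=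
    Finset.sum_nonneg fun x _ => Finset.sum_nonneg fun z _ => by split_ifs <;> norm_num
  have h4 : (((W ×ˢ Wᶜ).filter (fun p => A p.1 p.2)).card : ℤ) ≤
      (((S ×ˢ (Finset.Icc 1 n \ S)).filter (fun p => p.1 < p.2)).card : ℤ) := by
    exact_mod_cast hcard
  linarith
end

section
/- Let D = (V,A) be a digraph on n vertices with e-vector e, let g : V → {1,…,n} be an acyclic ordering of D, let z ∈ V be a maximal element of D (i.e., N⁺(z) = ∅), and let m = |N⁻(z)|. Then Σ_{x∈N⁻(z)} g(x) ≤ m(2n − m + 1)/2 + Σ_{x∈N⁻(z)} e(x). -/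
open Finset

/-- Inequality (16) of the paper: for an acyclic ordering `g` and a maximal
element `z` with in-degree `m`,
`Σ_{x∈N⁻(z)} g(x) ≤ m(2n − m + 1)/2 + Σ_{x∈N⁻(z)} e(x)`. -/
theorem stmt_10 {V : Type*} [Fintype V] [DecidableEq V]
    (A : V → V → Prop) [DecidableRel A]
    (hA : ∀ x y, A x y → x ≠ y)
    (n : ℕ) (hn : Fintype.card V = n)
    (e : V → ℤ)
    (he : ∀ x, e x = ((Finset.univ.filter (fun z => A z x)).card : ℤ)
                    - ((Finset.univ.filter (fun z => A x z)).card : ℤ))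
    (g : V → ℕ)
    (hg_inj : Function.Injective g)
    (hg_mem : ∀ x, g x ∈ Finset.Icc 1 n)
    (hg_ord : ∀ x y, A x y → g x < g y)
    (z : V) (hz_max : ∀ y, ¬ A z y)
    (m : ℕ) (hm : m = (Finset.univ.filter (fun x => A x z)).card) :
    (∑ x ∈ Finset.univ.filter (fun x => A x z), (g x : ℤ)) ≤
      (m : ℤ) * (2 * (n : ℤ) - (m : ℤ) + 1) / 2 +
        ∑ x ∈ Finset.univ.filter (fun x => A x z), e x := by
  set S := Finset.univ.filter (fun x => A x z) with hS
  have swap : ∀ (R : V → V → Prop) [DecidableRel R],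
      ∑ x ∈ S, ((S.filter (fun y => R x y)).card : ℤ) =
      ∑ x ∈ S, ((S.filter (fun y => R y x)).card : ℤ) := by
    intro R _
    have h := Finset.sum_card_bipartiteAbove_eq_sum_card_bipartiteBelow (s := S) (t := S) R
    simp only [Finset.bipartiteAbove, Finset.bipartiteBelow] at h
    exact_mod_cast h
  have h1 := swap A
  have h2 := swap (fun x y => g x < g y)
  have h3 : ∀ x ∈ S, ((S.filter (fun y => g x < g y)).card : ℤ)
      + ((S.filter (fun y => g y < g x)).card : ℤ) = (m : ℤ) - 1 := by
    intro x hx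
    have hd : Disjoint (S.filter (fun y => g x < g y)) (S.filter (fun y => g y < g x)) := by
      rw [Finset.disjoint_filter]
      intro y _ h
      omega
    have hu : S.filter (fun y => g x < g y) ∪ S.filter (fun y => g y < g x) = S.erase x := by
      ext y
      simp only [Finset.mem_union, Finset.mem_filter, Finset.mem_erase]
      constructor
      · rintro (⟨h, h'⟩ | ⟨h, h'⟩)
        · exact ⟨fun e => by subst e; omega, h⟩
        · exact ⟨fun e => by subst e; omega, h⟩
      · rintro ⟨h, h'⟩
        have : g y ≠ g x := fun e => h (hg_inj e)
        rcases lt_or_gt_of_ne this with h4 | h4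
        · exact Or.inr ⟨h', h4⟩
        · exact Or.inl ⟨h', h4⟩
    have hc := Finset.card_union_of_disjoint hd
    rw [hu] at hc
    have := Finset.card_erase_add_one hx
    omega
  have h4 : ∀ x ∈ S, (g x : ℤ) ≤ (n : ℤ) - ((S.filter (fun y => g x < g y)).card : ℤ)
      + ((S.filter (fun y => A x y)).card : ℤ) - ((S.filter (fun y => A y x)).card : ℤ)
      + e x := by
    intro x hx
    rw [he]
    have a1 : (S.filter (fun y => A y x)).card ≤ (Finset.univ.filter (fun y => A y x)).card :=
      Finset.card_le_card (Finset.filter_subset_filter _ (Finset.subset_univ _))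
    have a2 : (Finset.univ.filter (fun y => A x y)).card ≤
        (S.filter (fun y => A x y)).card + (Sᶜ.filter (fun y => g x < g y)).card := by
      refine le_trans (Finset.card_le_card ?_) (Finset.card_union_le _ _)
      intro y hy
      have hy' : A x y := by simpa using hy
      by_cases hyS : y ∈ S
      · exact Finset.mem_union_left _ (Finset.mem_filter.2 ⟨hyS, hy'⟩)
      · exact Finset.mem_union_right _
          (Finset.mem_filter.2 ⟨Finset.mem_compl.2 hyS, hg_ord _ _ hy'⟩)
    have a3 : (S.filter (fun y => g x < g y)).card + (Sᶜ.filter (fun y => g x < g y)).card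
        ≤ n - g x := by
      rw [← Finset.card_union_of_disjoint
        (Finset.disjoint_filter_filter disjoint_compl_right), ← Nat.card_Ioc]
      refine Finset.card_le_card_of_injOn g ?_ hg_inj.injOn
      intro y hy
      have hy2 : g x < g y := by
        simp only [Finset.coe_union, Set.mem_union, Finset.mem_coe, Finset.mem_filter] at hy
        tauto
      have := Finset.mem_Icc.1 (hg_mem y)
      simp only [Finset.coe_Ioc, Set.mem_Ioc]
      omega
    have := Finset.mem_Icc.1 (hg_mem x)
    omega
  have h5 := Finset.sum_le_sum h4
  have h6 := Finset.sum_congr rfl h3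
  simp only [Finset.sum_add_distrib, Finset.sum_sub_distrib, Finset.sum_const, nsmul_eq_mul,
    ← hm] at h5 h6
  have h7 : (∑ x ∈ S, (g x : ℤ)) - ∑ x ∈ S, e x ≤
      (m : ℤ) * (2 * (n : ℤ) - (m : ℤ) + 1) / 2 := by
    rw [Int.le_ediv_iff_mul_le (by norm_num)]
    linarith
  linarith
end

section
/- Let D₁ = (X,A₁) be a digraph on n+1 vertices with e-vector E, and let G : X → {1,…,n+1} be an acyclic ordering of D₁ satisfying the equality 2·⟨G,E⟩ = ⟨E,E⟩. Let z ∈ X be the unique element with G(z) = n+1, let V = X \ {z}, let D = D₁[V] be the digraph induced by D₁ on V (arc set A₁ ∩ (V×V)), and let e be the e-vector of D. Then the restriction g = G|_V is an acyclic ordering of D (a bijection V → {1,…,n}) and satisfies the equality 2·⟨g,e⟩ = ⟨e,e⟩. -/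
open Finset

/-- Indicator of a proposition-valued relation. -/
def ind12 (p : Prop) [Decidable p] : ℤ := if p then 1 else 0

/-- The summand over triples. -/
def term12 {X : Type*} [DecidableEq X] (A : X → X → Prop) [DecidableRel A] (G : X → ℕ)
    (x y w : X) : ℤ :=
  (ind12 (A y x) - ind12 (A x y)) *
    (2 * ind12 (G w < G x) - ind12 (A w x) + ind12 (A x w) - ind12 (y = w))

/-- The symmetrized summand. -/
def sym12 {X : Type*} [DecidableEq X] (A : X → X → Prop) [DecidableRel A] (G : X → ℕ)
    (x y w : X) : ℤ :=
  term12 A G x y w + term12 A G x w y + term12 A G y x w + term12 A G y w x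
    + term12 A G w x y + term12 A G w y x

theorem sym12_nonneg {X : Type*} [DecidableEq X] (A : X → X → Prop) [DecidableRel A] (G : X → ℕ)
    (hi : Function.Injective G) (ho : ∀ x y, A x y → G x < G y) (x y w : X) :
    0 ≤ sym12 A G x y w := by
  have no : ∀ x y, G y ≤ G x → ¬ A x y := fun x y h h' => by have := ho x y h'; omega
  have hne : ∀ x y, G x < G y → x ≠ y := fun x y h h' => by subst h'; omega
  have hs : ∀ x, ¬ A x x := fun x => no x x le_rfl
  rcases lt_trichotomy (G x) (G y) with h1 | h1 | h1 <;>
  rcases lt_trichotomy (G y) (G w) with h2 | h2 | h2 <;>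
  rcases lt_trichotomy (G x) (G w) with h3 | h3 | h3 <;>
  first
  | (exfalso; omega)
  | skip
  all_goals
    try have e1 := hi h1
    try have e2 := hi h2
    try have e3 := hi h3
    try subst e1
    try subst e2
    try subst e3
    try have n1 := no _ _ h1.le
    try have n2 := no _ _ h2.le
    try have n3 := no _ _ h3.le
    try have m1 := hne _ _ h1
    try have m2 := hne _ _ h2
    try have m3 := hne _ _ h3
    try have k1 := m1.symm
    try have k2 := m2.symm
    try have k3 := m3.symm
    try have l1 := h1.not_gt
    try have l2 := h2.not_gt
    try have l3 := h3.not_gt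
    simp only [sym12, term12, ind12, *, if_true, if_false, lt_irrefl]
    first | (split_ifs <;> simp_all; done) | norm_num

theorem rank12 {X : Type*} [Fintype X] (n : ℕ)
    (hn : Fintype.card X = n) (G : X → ℕ) (hi : Function.Injective G)
    (hm : ∀ x, G x ∈ Finset.Icc 1 n) (x : X) :
    (G x : ℤ) = 1 + ∑ y, ind12 (G y < G x) := by
  classical
  have himg : Finset.univ.image G = Finset.Icc 1 n := by
    apply Finset.eq_of_subset_of_card_le
    · intro k hk
      obtain ⟨y, -, rfl⟩ := Finset.mem_image.1 hk
      exact hm y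
    · rw [Finset.card_image_of_injective _ hi, Finset.card_univ, hn]; simp
  have h2 : (Finset.univ.filter (fun y => G y < G x)).image G = Finset.Ico 1 (G x) := by
    ext k
    simp only [Finset.mem_image, Finset.mem_filter, Finset.mem_univ, true_and, Finset.mem_Ico]
    constructor
    · rintro ⟨y, hy, rfl⟩
      exact ⟨(Finset.mem_Icc.1 (hm y)).1, hy⟩
    · rintro ⟨ha, hb⟩
      have := (Finset.mem_Icc.1 (hm x)).2
      have hk : k ∈ Finset.univ.image G := by
        rw [himg, Finset.mem_Icc]; omega
      obtain ⟨y, -, rfl⟩ := Finset.mem_image.1 hk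
      exact ⟨y, hb, rfl⟩
  have h3 := congrArg Finset.card h2
  rw [Finset.card_image_of_injective _ hi, Nat.card_Ico] at h3
  have h1 := (Finset.mem_Icc.1 (hm x)).1
  have h4 : ∑ y, ind12 (G y < G x) = ((Finset.univ.filter (fun y => G y < G x)).card : ℤ) := by
    simp [ind12]
  rw [h4, h3]
  omega

theorem sum_sym12 {X : Type*} [Fintype X] [DecidableEq X] (A : X → X → Prop) [DecidableRel A]
    (n : ℕ) (hn : Fintype.card X = n) (G : X → ℕ) (hi : Function.Injective G)
    (hm : ∀ x, G x ∈ Finset.Icc 1 n) (E : X → ℤ)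
    (hE : ∀ x, E x = ((Finset.univ.filter (fun z => A z x)).card : ℤ)
                    - ((Finset.univ.filter (fun z => A x z)).card : ℤ)) :
    ∑ x, ∑ y, ∑ w, sym12 A G x y w = 6 * (2 * ∑ x, E x * (G x : ℤ) - ∑ x, E x * E x) := by
  have hE' : ∀ x, E x = ∑ y, (ind12 (A y x) - ind12 (A x y)) := by
    intro x; rw [hE, Finset.sum_sub_distrib]; simp [ind12]
  have hE0 : ∑ x, E x = 0 := by
    simp only [hE', Finset.sum_sub_distrib]
    rw [Finset.sum_comm]; simp
  have key : ∑ x, ∑ y, ∑ w, term12 A G x y w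
      = 2 * ∑ x, E x * (G x : ℤ) - ∑ x, E x * E x := by
    have hx : ∀ x, ∑ y, ∑ w, term12 A G x y w
        = 2 * (E x * (G x : ℤ)) - E x * E x - 3 * E x := by
      intro x
      have h1 : ∀ y, ∑ w, term12 A G x y w
          = (ind12 (A y x) - ind12 (A x y)) * (2 * ((G x : ℤ) - 1) - E x - 1) := by
        intro y
        simp only [term12]
        rw [← Finset.mul_sum]
        congr 1
        rw [rank12 n hn G hi hm x, hE' x]
        simp only [Finset.sum_sub_distrib, Finset.sum_add_distrib, ← Finset.mul_sum]
        have : ∑ w, ind12 (y = w) = 1 := by simp [ind12]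
        rw [this]; ring
      simp only [h1]
      rw [← Finset.sum_mul, ← hE' x]; ring
    simp only [hx, Finset.sum_sub_distrib, ← Finset.mul_sum, hE0]
    ring
  simp only [sym12, Finset.sum_add_distrib]
  have c1 : ∀ f : X → X → X → ℤ, ∑ x, ∑ y, ∑ w, f x w y = ∑ x, ∑ y, ∑ w, f x y w :=
    fun f => Finset.sum_congr rfl fun x _ => Finset.sum_comm
  have c2 : ∀ f : X → X → X → ℤ, ∑ x, ∑ y, ∑ w, f y x w = ∑ x, ∑ y, ∑ w, f x y w :=
    fun f => Finset.sum_comm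
  rw [c1 (fun x y w => term12 A G x y w), c2 (fun x y w => term12 A G x y w),
    c2 (fun x y w => term12 A G x w y), c1 (fun x y w => term12 A G x y w),
    c1 (fun x w y => term12 A G w x y), c2 (fun x y w => term12 A G x y w),
    c1 (fun x w y => term12 A G w y x), c2 (fun x y w => term12 A G x w y),
    c1 (fun x y w => term12 A G x y w), key]
  ring

/-- Lemma 2 of the paper: if an acyclic ordering `G` of a digraph `D₁` on `n+1`
vertices satisfies `2⟨G,E⟩ = ⟨E,E⟩` and `z` is the element with `G(z) = n+1`,
then the restriction `g` of `G` to `V = X \ {z}` is an acyclic ordering of the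
induced digraph `D = D₁[V]` and satisfies `2⟨g,e⟩ = ⟨e,e⟩` for the `e`-vector of `D`. -/
theorem stmt_12 {X : Type*} [Fintype X] [DecidableEq X]
    (A : X → X → Prop) [DecidableRel A]
    (hA : ∀ x y, A x y → x ≠ y)
    (n : ℕ) (hn : Fintype.card X = n + 1)
    (E : X → ℤ)
    (hE : ∀ x, E x = ((Finset.univ.filter (fun z => A z x)).card : ℤ)
                    - ((Finset.univ.filter (fun z => A x z)).card : ℤ))
    (G : X → ℕ)
    (hG_inj : Function.Injective G)
    (hG_mem : ∀ x, G x ∈ Finset.Icc 1 (n + 1))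
    (hG_ord : ∀ x y, A x y → G x < G y)
    (heq : 2 * ∑ x, E x * (G x : ℤ) = ∑ x, E x * E x)
    (z : X) (hz : G z = n + 1)
    (e : {x : X // x ≠ z} → ℤ)
    (he : ∀ x : {x : X // x ≠ z},
      e x = ((Finset.univ.filter (fun y : {x : X // x ≠ z} => A y.1 x.1)).card : ℤ)
          - ((Finset.univ.filter (fun y : {x : X // x ≠ z} => A x.1 y.1)).card : ℤ))
    (g : {x : X // x ≠ z} → ℕ)
    (hg : ∀ x : {x : X // x ≠ z}, g x = G x.1) :
    Function.Injective g ∧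
    (∀ x, g x ∈ Finset.Icc 1 n) ∧
    (∀ x y : {x : X // x ≠ z}, A x.1 y.1 → g x < g y) ∧
    2 * ∑ x, e x * (g x : ℤ) = ∑ x, e x * e x := by
  have gi : Function.Injective g := by
    intro x y h
    rw [hg, hg] at h
    exact Subtype.ext (hG_inj h)
  have gm : ∀ x, g x ∈ Finset.Icc 1 n := by
    intro x
    have h1 := Finset.mem_Icc.1 (hG_mem x.1)
    have h2 : G x.1 ≠ n + 1 := fun h => x.2 (hG_inj (h.trans hz.symm))
    rw [hg, Finset.mem_Icc]
    omega
  have go : ∀ x y : {x : X // x ≠ z}, A x.1 y.1 → g x < g y := by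
    intro x y h
    rw [hg, hg]
    exact hG_ord _ _ h
  refine ⟨gi, gm, go, ?_⟩
  have hcard : Fintype.card {x : X // x ≠ z} = n := by
    rw [Fintype.card_subtype_compl, hn]; simp
  have big := sum_sym12 A (n + 1) hn G hG_inj hG_mem E hE
  rw [heq, sub_self, mul_zero] at big
  have nn := sym12_nonneg A G hG_inj hG_ord
  have zero : ∀ x y w, sym12 A G x y w = 0 := by
    intro x y w
    have b1 := (Finset.sum_eq_zero_iff_of_nonneg (fun x _ =>
      Finset.sum_nonneg fun y _ => Finset.sum_nonneg fun w _ => nn x y w)).1 big x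
      (Finset.mem_univ _)
    have b2 := (Finset.sum_eq_zero_iff_of_nonneg (fun y _ =>
      Finset.sum_nonneg fun w _ => nn x y w)).1 b1 y (Finset.mem_univ _)
    exact (Finset.sum_eq_zero_iff_of_nonneg (fun w _ => nn x y w)).1 b2 w (Finset.mem_univ _)
  have small := sum_sym12 (fun x y : {x : X // x ≠ z} => A x.1 y.1) n hcard g gi gm e he
  have zs : ∀ x y w : {x : X // x ≠ z},
      sym12 (fun x y : {x : X // x ≠ z} => A x.1 y.1) g x y w = 0 := by
    intro x y w
    rw [← zero x.1 y.1 w.1]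
    simp only [sym12, term12, ind12, hg, Subtype.ext_iff]
  simp only [zs, Finset.sum_const_zero] at small
  omega
end

section
/- Let D₁ = (X,A₁) be a digraph on n+1 vertices with e-vector E, and let G : X → {1,…,n+1} be an acyclic ordering of D₁ satisfying 2·⟨G,E⟩ = ⟨E,E⟩. Let z ∈ X be the unique element with G(z) = n+1, let V = X \ {z}, let e be the e-vector of the induced digraph D = D₁[V], and let g = G|_V. Then with m = |N⁻(z)| (in-degree of z in D₁), equality holds in the bound of the maximal-element lemma: Σ_{x∈N⁻(z)} (e(x) − g(x)) + n·m = m(m−1)/2. -/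
open Finset

/-- Signed adjacency. -/
def dd {X : Type*} (A : X → X → Prop) [DecidableRel A] (x y : X) : ℤ :=
  (if A y x then 1 else 0) - (if A x y then 1 else 0)

/-- The e-vector of the digraph induced on `V`. -/
def ee {X : Type*} (A : X → X → Prop) [DecidableRel A] (V : Finset X) (x : X) : ℤ :=
  ∑ y ∈ V, dd A x y

theorem dd_self {X : Type*} (A : X → X → Prop) [DecidableRel A] (x : X) : dd A x x = 0 := by
  simp [dd]

theorem dd_antisum {X : Type*} (A : X → X → Prop) [DecidableRel A] (N : Finset X) :
    ∑ x ∈ N, ∑ y ∈ N, dd A x y = 0 := by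
  have h : ∑ x ∈ N, ∑ y ∈ N, dd A x y = ∑ x ∈ N, ∑ y ∈ N, - dd A x y := by
    rw [Finset.sum_comm]
    refine Finset.sum_congr rfl fun x _ => Finset.sum_congr rfl fun y _ => ?_
    simp [dd]
  simp only [Finset.sum_neg_distrib] at h
  linarith

theorem pairs_count {X : Type*} [DecidableEq X] (G : X → ℕ) (hG : Function.Injective G)
    (N : Finset X) :
    2 * ∑ x ∈ N, ∑ y ∈ N, (if G x < G y then (1 : ℤ) else 0) = (N.card : ℤ) * (N.card - 1) := by
  have h1 : ∑ x ∈ N, ∑ y ∈ N, (if G x < G y then (1 : ℤ) else 0)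
      = ∑ x ∈ N, ∑ y ∈ N, (if G y < G x then (1 : ℤ) else 0) := Finset.sum_comm
  have h2 : ∑ x ∈ N, ∑ y ∈ N, (if G x < G y then (1 : ℤ) else 0)
      + ∑ x ∈ N, ∑ y ∈ N, (if G y < G x then (1 : ℤ) else 0)
      = ∑ x ∈ N, ∑ y ∈ N, (1 - (if x = y then (1 : ℤ) else 0)) := by
    rw [← Finset.sum_add_distrib]
    refine Finset.sum_congr rfl fun x _ => ?_
    rw [← Finset.sum_add_distrib]
    refine Finset.sum_congr rfl fun y _ => ?_
    rcases lt_trichotomy (G x) (G y) with h | h | h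
    · have : x ≠ y := fun e => by subst e; omega
      simp [h, this, h.le]
    · have := hG h
      simp [this]
    · have : x ≠ y := fun e => by subst e; omega
      simp [h, this, h.le]
  have h3 : ∑ x ∈ N, ∑ y ∈ N, (1 - (if x = y then (1 : ℤ) else 0))
      = (N.card : ℤ) * (N.card - 1) := by
    have : ∀ x ∈ N, ∑ y ∈ N, (1 - (if x = y then (1 : ℤ) else 0)) = (N.card : ℤ) - 1 := by
      intro x hx
      rw [Finset.sum_sub_distrib]
      simp [hx]
    rw [Finset.sum_congr rfl this, Finset.sum_const, nsmul_eq_mul]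
  linarith

theorem key_bound {X : Type*} [DecidableEq X] (A : X → X → Prop) [DecidableRel A]
    (G : X → ℕ) (hG : Function.Injective G) (hord : ∀ x y, A x y → G x < G y)
    (n : ℕ) (V N : Finset X) (hV : V.image G = Finset.Icc 1 n) (hN : N ⊆ V) :
    (N.card : ℤ) * (N.card - 1) ≤ 2 * (∑ x ∈ N, (ee A V x - G x) + n * N.card) := by
  have hsplit : ∀ f : X → X → ℤ, ∑ x ∈ N, ∑ y ∈ V, f x y
      = ∑ x ∈ N, ∑ y ∈ V \ N, f x y + ∑ x ∈ N, ∑ y ∈ N, f x y := by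
    intro f
    rw [← Finset.sum_add_distrib]
    exact Finset.sum_congr rfl fun x _ => (Finset.sum_sdiff hN).symm
  have h1 := hsplit (dd A)
  have h2 := hsplit (fun x y => if G x < G y then (1 : ℤ) else 0)
  rw [dd_antisum] at h1
  have h3 : ∑ x ∈ N, ∑ y ∈ V \ N, (-(if G x < G y then (1 : ℤ) else 0))
      ≤ ∑ x ∈ N, ∑ y ∈ V \ N, dd A x y := by
    refine Finset.sum_le_sum fun x _ => Finset.sum_le_sum fun y _ => ?_
    have := hord x y
    unfold dd
    split_ifs <;> simp_all
  simp only [Finset.sum_neg_distrib] at h3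
  have h4 : ∑ x ∈ N, ∑ y ∈ V, (if G x < G y then (1 : ℤ) else 0) = ∑ x ∈ N, ((n : ℤ) - G x) := by
    refine Finset.sum_congr rfl fun x hx => ?_
    have hx1 : G x ∈ Finset.Icc 1 n := hV ▸ Finset.mem_image_of_mem G (hN hx)
    rw [Finset.mem_Icc] at hx1
    have : ∑ y ∈ V, (if G x < G y then (1 : ℤ) else 0)
        = ∑ j ∈ V.image G, (if G x < j then (1 : ℤ) else 0) := by
      rw [Finset.sum_image (fun a _ b _ h => hG h)]
    rw [this, hV, ← Finset.sum_filter]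
    have h5 : (Finset.Icc 1 n).filter (fun j => G x < j) = Finset.Ioc (G x) n := by
      ext j; simp only [Finset.mem_filter, Finset.mem_Icc, Finset.mem_Ioc]; omega
    rw [h5]
    simp only [Finset.sum_const, Nat.card_Ioc, nsmul_eq_mul, mul_one]
    omega
  have h5 := pairs_count G hG N
  have h6 : ∑ x ∈ N, (ee A V x - (G x : ℤ)) = ∑ x ∈ N, ∑ y ∈ V, dd A x y - ∑ x ∈ N, (G x : ℤ) := by
    rw [Finset.sum_sub_distrib]; rfl
  have h7 : ∑ x ∈ N, ((n : ℤ) - G x) = n * N.card - ∑ x ∈ N, (G x : ℤ) := by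
    rw [Finset.sum_sub_distrib]; simp [mul_comm]
  linarith

theorem step_eq {X : Type*} [DecidableEq X] (A : X → X → Prop) [DecidableRel A]
    (G : X → ℕ) (n : ℕ) (V : Finset X) (z : X) (hz : G z = n + 1) (hzV : z ∉ V)
    (hmax : ∀ x ∈ V, ¬ A z x) :
    ∑ x ∈ insert z V, ee A (insert z V) x * (2 * G x - ee A (insert z V) x)
    = ∑ x ∈ V, ee A V x * (2 * G x - ee A V x)
      + 2 * (∑ x ∈ V.filter (fun x => A x z), (ee A V x - G x)
        + n * (V.filter (fun x => A x z)).card)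
      - ((V.filter (fun x => A x z)).card : ℤ) * ((V.filter (fun x => A x z)).card - 1) := by
  set m : ℤ := ((V.filter (fun x => A x z)).card : ℤ) with hm
  have hm' : m = ∑ x ∈ V, (if A x z then (1 : ℤ) else 0) := by
    rw [hm]; simp
  have hez : ee A (insert z V) z = m := by
    unfold ee
    rw [Finset.sum_insert hzV, dd_self, zero_add, hm']
    refine Finset.sum_congr rfl fun x hx => ?_
    simp [dd, hmax x hx]
  have hex : ∀ x ∈ V, ee A (insert z V) x = ee A V x - (if A x z then 1 else 0) := by
    intro x hx
    unfold ee
    rw [Finset.sum_insert hzV]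
    simp only [dd, hmax x hx, if_false]
    ring
  rw [Finset.sum_insert hzV, hez, hz]
  have h1 : ∑ x ∈ V, ee A (insert z V) x * (2 * G x - ee A (insert z V) x)
      = ∑ x ∈ V, ee A V x * (2 * G x - ee A V x)
        + 2 * ∑ x ∈ V.filter (fun x => A x z), (ee A V x - G x) - m := by
    rw [Finset.sum_filter, hm', Finset.mul_sum, ← Finset.sum_add_distrib,
      ← Finset.sum_sub_distrib]
    refine Finset.sum_congr rfl fun x hx => ?_
    rw [hex x hx]
    split_ifs <;> ring
  rw [h1]
  push_cast
  ring

theorem F_nonneg {X : Type*} [DecidableEq X] (A : X → X → Prop) [DecidableRel A]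
    (G : X → ℕ) (hG : Function.Injective G) (hord : ∀ x y, A x y → G x < G y)
    (n : ℕ) : ∀ (V : Finset X), V.image G = Finset.Icc 1 n →
    0 ≤ ∑ x ∈ V, ee A V x * (2 * G x - ee A V x) := by
  induction n with
  | zero =>
    intro V hV
    have : V = ∅ := by simpa using hV
    simp [this]
  | succ n ih =>
    intro V hV
    have hmem : n + 1 ∈ V.image G := by rw [hV]; simp
    obtain ⟨z, hzV, hz⟩ := Finset.mem_image.1 hmem
    have hW : (V.erase z).image G = Finset.Icc 1 n := by
      rw [Finset.image_erase hG, hV, hz]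
      ext j; simp only [Finset.mem_erase, Finset.mem_Icc]; omega
    have hmax : ∀ x ∈ V.erase z, ¬ A z x := by
      intro x hx h
      have h1 := hord _ _ h
      have h2 : G x ∈ Finset.Icc 1 n := hW ▸ Finset.mem_image_of_mem G hx
      rw [Finset.mem_Icc] at h2; omega
    have h1 := step_eq A G n (V.erase z) z hz (Finset.notMem_erase z V) hmax
    rw [Finset.insert_erase hzV] at h1
    have h2 := ih _ hW
    have h3 := key_bound A G hG hord n (V.erase z) _ hW
      (Finset.filter_subset (fun x => A x z) _)
    linarith

/-- Remark after Lemma 2 of the paper: under the hypotheses of Lemma 2 (acyclic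
ordering `G` of `D₁` with `2⟨G,E⟩ = ⟨E,E⟩`, `z` the element with `G(z) = n+1`,
`e` the `e`-vector of the induced digraph `D = D₁[X \ {z}]`, `g = G` restricted),
equality holds in the bound of the maximal-element lemma:
`Σ_{x∈N⁻(z)} (e(x) − g(x)) + n·m = m(m−1)/2`, where `m = |N⁻(z)|` in `D₁`. -/
theorem stmt_13 {X : Type*} [Fintype X] [DecidableEq X]
    (A : X → X → Prop) [DecidableRel A]
    (hA : ∀ x y, A x y → x ≠ y)
    (n : ℕ) (hn : Fintype.card X = n + 1)
    (E : X → ℤ)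
    (hE : ∀ x, E x = ((Finset.univ.filter (fun z => A z x)).card : ℤ)
                    - ((Finset.univ.filter (fun z => A x z)).card : ℤ))
    (G : X → ℕ)
    (hG_inj : Function.Injective G)
    (hG_mem : ∀ x, G x ∈ Finset.Icc 1 (n + 1))
    (hG_ord : ∀ x y, A x y → G x < G y)
    (heq : 2 * ∑ x, E x * (G x : ℤ) = ∑ x, E x * E x)
    (z : X) (hz : G z = n + 1)
    (e : X → ℤ)
    (he : ∀ x, e x = (((Finset.univ.erase z).filter (fun y => A y x)).card : ℤ)
                   - (((Finset.univ.erase z).filter (fun y => A x y)).card : ℤ))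
    (m : ℕ) (hm : m = (Finset.univ.filter (fun x => A x z)).card) :
    (∑ x ∈ Finset.univ.filter (fun x => A x z), (e x - (G x : ℤ))) + (n : ℤ) * m =
      (m : ℤ) * ((m : ℤ) - 1) / 2 := by
  have hee : ∀ (V : Finset X) x, ee A V x = ((V.filter (fun y => A y x)).card : ℤ)
      - ((V.filter (fun y => A x y)).card : ℤ) := by
    intro V x
    simp [ee, dd, Finset.sum_sub_distrib]
  have hEe : ∀ x, E x = ee A Finset.univ x := fun x => by rw [hE, hee]
  have hee' : ∀ x, e x = ee A (Finset.univ.erase z) x := fun x => by rw [he, hee]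
  have hU : (Finset.univ : Finset X).image G = Finset.Icc 1 (n + 1) := by
    apply Finset.eq_of_subset_of_card_le
    · intro j hj
      obtain ⟨x, _, rfl⟩ := Finset.mem_image.1 hj
      exact hG_mem x
    · rw [Finset.card_image_of_injective _ hG_inj, Finset.card_univ, hn]; simp
  have hW : (Finset.univ.erase z).image G = Finset.Icc 1 n := by
    rw [Finset.image_erase hG_inj, hU, hz]
    ext j; simp only [Finset.mem_erase, Finset.mem_Icc]; omega
  have hmax : ∀ x ∈ Finset.univ.erase z, ¬ A z x := by
    intro x hx h
    have h1 := hG_ord _ _ h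
    have h2 := Finset.mem_Icc.1 (hG_mem x)
    omega
  have h1 := step_eq A G n (Finset.univ.erase z) z hz (Finset.notMem_erase z _) hmax
  rw [Finset.insert_erase (Finset.mem_univ z)] at h1
  have h2 := F_nonneg A G hG_inj hG_ord n _ hW
  have h3 := key_bound A G hG_inj hG_ord n (Finset.univ.erase z) _ hW
    (Finset.filter_subset (fun x => A x z) _)
  have hN : (Finset.univ.erase z).filter (fun x => A x z)
      = Finset.univ.filter (fun x => A x z) := by
    ext x
    simp only [Finset.mem_filter, Finset.mem_erase, Finset.mem_univ, and_true, true_and]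
    exact ⟨fun h => h.2, fun h => ⟨hA _ _ h, h⟩⟩
  rw [hN, ← hm] at h1 h3
  have h0 : ∑ x, ee A Finset.univ x * (2 * (G x : ℤ) - ee A Finset.univ x) = 0 := by
    have : ∑ x, ee A Finset.univ x * (2 * (G x : ℤ) - ee A Finset.univ x)
        = 2 * ∑ x, E x * (G x : ℤ) - ∑ x, E x * E x := by
      rw [Finset.mul_sum, ← Finset.sum_sub_distrib]
      refine Finset.sum_congr rfl fun x _ => ?_
      rw [hEe]; ring
    rw [this, heq, sub_self]
  simp only [hee']
  have h4 : (m : ℤ) * ((m : ℤ) - 1) = 2 * (∑ x ∈ Finset.univ.filter (fun x => A x z),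
      (ee A (Finset.univ.erase z) x - (G x : ℤ)) + n * m) := by
    linarith
  rw [h4]
  simp
end

section
/- Let D = (V,A) be a digraph on n vertices with e-vector e, let g : V → {1,…,n} be an acyclic ordering of D satisfying 2·⟨e,g⟩ = ⟨e,e⟩, let z ∈ V be the element with g(z) = n, and define f(x) = n + 1 − g(x) + e(x). Then f(z) = |N⁻(z)| + 1, and for every x ∈ V \ {z}: f(x) < f(z) if and only if x ∈ N⁻(z); consequently the image of N⁻(z) under f is exactly the interval {1,…,|N⁻(z)|}. -/
open Finset

/-- Cyclic triple count of a tournament in terms of its scores. -/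
theorem tour_cyc {V : Type*} [Fintype V] [DecidableEq V] (b : V → V → ℤ) (s : V → ℤ)
    (hs : ∀ x, s x = ∑ y, b x y)
    (h1 : ∀ x y, b x y + b y x = 1 - (if x = y then 1 else 0))
    (h2 : ∀ x y, b x y * b x y = b x y) :
    2 * ∑ x, ∑ y, ∑ w, b x y * b y w * b w x =
      2 * ∑ y, ((Fintype.card V : ℤ) - 1 - s y) * s y - ∑ x, s x * s x + ∑ x, s x := by
  have hin : ∀ y, (Fintype.card V : ℤ) - 1 - s y = ∑ x, b x y := by
    intro y
    have : ∑ x, (b x y + b y x) = ∑ x, (1 - (if x = y then 1 else 0) : ℤ) :=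
      Finset.sum_congr rfl (fun x _ => h1 x y)
    rw [Finset.sum_add_distrib, ← hs, Finset.sum_sub_distrib] at this
    simp at this
    linarith
  have hsq : ∑ x, s x * s x = 2 * (∑ x, ∑ y, ∑ w, b x y * b x w * b y w) + ∑ x, s x := by
    rw [Finset.mul_sum, ← Finset.sum_add_distrib]
    apply Finset.sum_congr rfl
    intro x _
    have e1 : s x * s x = ∑ y, ∑ w, (b x y * b x w * b y w + b x y * b x w * b w y
        + (if y = w then b x y * b x w else 0)) := by
      rw [hs, Finset.sum_mul_sum]
      refine Finset.sum_congr rfl (fun y _ => Finset.sum_congr rfl (fun w _ => ?_))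
      have := h1 y w
      split_ifs at this ⊢ <;> linear_combination (-(b x y * b x w)) * this
    have e2 : ∑ y, ∑ w, b x y * b x w * b w y = ∑ y, ∑ w, b x y * b x w * b y w := by
      rw [Finset.sum_comm]
      refine Finset.sum_congr rfl (fun y _ => Finset.sum_congr rfl (fun w _ => ?_))
      ring
    rw [e1]
    simp only [Finset.sum_add_distrib]
    rw [e2]
    simp [h2, ← hs]
    ring
  have hpr : ∑ y, ((Fintype.card V : ℤ) - 1 - s y) * s y =
      (∑ x, ∑ y, ∑ w, b x y * b x w * b y w) + ∑ x, ∑ y, ∑ w, b x y * b y w * b w x := by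
    have e1 : ∑ y, ((Fintype.card V : ℤ) - 1 - s y) * s y
        = ∑ x, ∑ y, ∑ w, b x y * b y w := by
      rw [Finset.sum_comm]
      refine Finset.sum_congr rfl (fun y _ => ?_)
      rw [hin, hs, Finset.sum_mul_sum]
    rw [e1, ← Finset.sum_add_distrib]
    refine Finset.sum_congr rfl (fun x _ => ?_)
    rw [← Finset.sum_add_distrib]
    refine Finset.sum_congr rfl (fun y _ => ?_)
    rw [← Finset.sum_add_distrib]
    refine Finset.sum_congr rfl (fun w _ => ?_)
    have := h1 x w
    by_cases hxw : x = w
    · subst hxw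
      have h3 := h1 x y
      have hz0 : b x y * b y x = 0 := by
        have h4 := h2 x y
        split_ifs at h3 with hxy
        · subst hxy
          have : b x x = 0 := by linarith
          simp [this]
        · linear_combination (b x y) * h3 - h4
      linear_combination (1 - 2 * b x x) * hz0
    · rw [if_neg hxw] at this
      linear_combination (-(b x y * b y w)) * this
  linarith

/-- From the proof of Theorem 2: if the acyclic ordering `g` attains the equality
`2⟨e,g⟩ = ⟨e,e⟩`, `z` is the element with `g(z) = n`, and `f = n + 1 − g + e`, then
`f(z) = |N⁻(z)| + 1`, for every `x ≠ z` we have `f(x) < f(z)` iff `x ∈ N⁻(z)`, and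
the image of `N⁻(z)` under `f` is exactly the interval `{1,…,|N⁻(z)|}`. -/
theorem stmt_15 {V : Type*} [Fintype V] [DecidableEq V]
    (A : V → V → Prop) [DecidableRel A]
    (hA : ∀ x y, A x y → x ≠ y)
    (n : ℕ) (hn : Fintype.card V = n)
    (e : V → ℤ)
    (he : ∀ x, e x = ((Finset.univ.filter (fun z => A z x)).card : ℤ)
                    - ((Finset.univ.filter (fun z => A x z)).card : ℤ))
    (g : V → ℕ)
    (hg_inj : Function.Injective g)
    (hg_mem : ∀ x, g x ∈ Finset.Icc 1 n)
    (hg_ord : ∀ x y, A x y → g x < g y)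
    (heq : 2 * ∑ x, e x * (g x : ℤ) = ∑ x, e x * e x)
    (z : V) (hz : g z = n)
    (f : V → ℤ)
    (hf : ∀ x, f x = (n : ℤ) + 1 - (g x : ℤ) + e x) :
    f z = ((Finset.univ.filter (fun x => A x z)).card : ℤ) + 1 ∧
    (∀ x, x ≠ z → (f x < f z ↔ A x z)) ∧
    (Finset.univ.filter (fun x => A x z)).image f =
      Finset.Icc (1 : ℤ) ((Finset.univ.filter (fun x => A x z)).card : ℤ) := by
  have hcard : ∀ x, (∑ y, (if g x < g y then 1 else 0) : ℤ) = (n : ℤ) - g x := by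
    intro x
    have himg : (Finset.univ : Finset V).image g = Finset.Icc 1 n := by
      apply Finset.eq_of_subset_of_card_le
      · intro k hk
        obtain ⟨y, -, rfl⟩ := Finset.mem_image.1 hk
        exact hg_mem y
      · rw [Finset.card_image_of_injective _ hg_inj, Finset.card_univ, hn]
        simp
    have h3 : (Finset.univ.filter (fun y => g x < g y)).image g = Finset.Ioc (g x) n := by
      ext k
      simp only [Finset.mem_image, Finset.mem_filter, Finset.mem_univ, true_and, Finset.mem_Ioc]
      constructor
      · rintro ⟨y, hy, rfl⟩
        exact ⟨hy, (Finset.mem_Icc.1 (hg_mem y)).2⟩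
      · rintro ⟨h1, h2⟩
        have : k ∈ (Finset.univ : Finset V).image g := by
          rw [himg, Finset.mem_Icc]; omega
        obtain ⟨y, -, rfl⟩ := Finset.mem_image.1 this
        exact ⟨y, h1, rfl⟩
    have h4 := congrArg Finset.card h3
    rw [Finset.card_image_of_injective _ hg_inj, Nat.card_Ioc] at h4
    have h5 := (Finset.mem_Icc.1 (hg_mem x)).2
    rw [Finset.sum_boole, h4]
    push_cast [h5]
    ring
  let t : V → V → ℤ := fun x y => if g x < g y then 1 else 0
  let b : V → V → ℤ := fun x y => t x y + (if A y x then 1 else 0) - (if A x y then 1 else 0)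
  let s' : V → ℤ := fun x => n - g x
  let s : V → ℤ := fun x => s' x + e x
  have hs' : ∀ x, s' x = ∑ y, t x y := fun x => (hcard x).symm
  have hs : ∀ x, s x = ∑ y, b x y := by
    intro x
    simp only [b, s, Finset.sum_sub_distrib, Finset.sum_add_distrib, ← hs', he,
      Finset.sum_boole]
    ring
  have hb01 : ∀ x y, b x y = if (A y x ∨ (g x < g y ∧ ¬ A x y)) then 1 else 0 := by
    intro x y
    have h1 := hg_ord x y
    have h2 := hg_ord y x
    simp only [b, t]
    by_cases a1 : A x y <;> by_cases a2 : A y x <;> by_cases a3 : g x < g y <;>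
      simp [a1, a2, a3] at h1 h2 ⊢
    all_goals omega
  have ht1 : ∀ x y, t x y + t y x = 1 - (if x = y then 1 else 0) := by
    intro x y
    simp only [t]
    by_cases hxy : x = y
    · subst hxy; simp
    · have : g x ≠ g y := fun h => hxy (hg_inj h)
      rcases lt_or_gt_of_ne this with h | h
      · simp [h, hxy, h.le]
      · simp [h, hxy, h.le]
  have hb1 : ∀ x y, b x y + b y x = 1 - (if x = y then 1 else 0) := by
    intro x y
    rw [← ht1]; simp only [b]; ring
  have ht2 : ∀ x y, t x y * t x y = t x y := by
    intro x y; simp only [t]; split_ifs <;> simp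
  have hb2 : ∀ x y, b x y * b x y = b x y := by
    intro x y; rw [hb01]; split_ifs <;> simp
  have hb0 : ∀ x y, 0 ≤ b x y := by
    intro x y; rw [hb01]; split_ifs <;> simp
  have hC' : ∑ x, ∑ y, ∑ w, t x y * t y w * t w x = 0 := by
    refine Finset.sum_eq_zero fun x _ => Finset.sum_eq_zero fun y _ =>
      Finset.sum_eq_zero fun w _ => ?_
    simp only [t]
    split_ifs <;> simp
    all_goals omega
  have hse : ∑ x, e x = 0 := by
    simp only [he, Finset.sum_sub_distrib, ← Finset.sum_boole]
    rw [Finset.sum_comm, sub_self]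
  have hss : ∑ x, s x = ∑ x, s' x := by
    simp only [s, Finset.sum_add_distrib, hse, add_zero]
  have hsq : ∑ x, s x * s x = ∑ x, s' x * s' x := by
    have : ∀ x, s x * s x = s' x * s' x + 2 * n * e x - 2 * (e x * g x) + e x * e x := by
      intro x; simp only [s, s']; ring
    simp only [this, Finset.sum_add_distrib, Finset.sum_sub_distrib, ← Finset.mul_sum, hse]
    linarith
  have hC : ∑ x, ∑ y, ∑ w, b x y * b y w * b w x = 0 := by
    have k1 := tour_cyc b s hs hb1 hb2
    have k2 := tour_cyc t s' hs' ht1 ht2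
    have k3 : ∀ r : V → ℤ, ∑ y, ((Fintype.card V : ℤ) - 1 - r y) * r y =
        ((Fintype.card V : ℤ) - 1) * ∑ y, r y - ∑ y, r y * r y := by
      intro r
      rw [Finset.mul_sum, ← Finset.sum_sub_distrib]
      exact Finset.sum_congr rfl fun y _ => by ring
    rw [k3] at k1 k2
    rw [hss, hsq] at k1
    linarith
  have hnn : ∀ x y w, 0 ≤ b x y * b y w * b w x := fun x y w =>
    mul_nonneg (mul_nonneg (hb0 _ _) (hb0 _ _)) (hb0 _ _)
  have hcyc : ∀ x y w, b x y * b y w * b w x = 0 := by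
    intro x y w
    rw [Finset.sum_eq_zero_iff_of_nonneg (fun x _ => Finset.sum_nonneg fun y _ =>
      Finset.sum_nonneg fun w _ => hnn x y w)] at hC
    have k := hC x (Finset.mem_univ _)
    rw [Finset.sum_eq_zero_iff_of_nonneg (fun y _ =>
      Finset.sum_nonneg fun w _ => hnn x y w)] at k
    have k := k y (Finset.mem_univ _)
    rw [Finset.sum_eq_zero_iff_of_nonneg (fun w _ => hnn x y w)] at k
    exact k w (Finset.mem_univ _)
  have hbb : ∀ x y, b x y = 0 ∨ b x y = 1 := by
    intro x y; rw [hb01]; split_ifs <;> simp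
  have hbd : ∀ x, b x x = 0 := by
    intro x
    have := hb1 x x
    simp at this
    linarith
  have hlt : ∀ x y, b x y = 1 → f y < f x := by
    intro x y hxy
    have hfs : ∀ x, f x = s x + 1 := by
      intro x; rw [hf]; simp only [s, s']; ring
    rw [hfs, hfs, hs, hs]
    have : ∑ w, b y w < ∑ w, b x w := by
      apply Finset.sum_lt_sum
      · intro w _
        rcases hbb y w with h | h
        · rw [h]; exact hb0 _ _
        · have k := hcyc x y w
          rw [hxy, h] at k
          have k2 := hb1 x w
          by_cases hxw : x = w
          · subst hxw
            have := hb1 x y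
            have := hb0 x x
            split_ifs at * <;> linarith
          · rw [if_neg hxw] at k2
            linarith
      · exact ⟨y, Finset.mem_univ _, by rw [hbd, hxy]; norm_num⟩
    linarith
  have hiff : ∀ x y, x ≠ y → (f y < f x ↔ b x y = 1) := by
    intro x y hxy
    refine ⟨fun h => ?_, hlt x y⟩
    rcases hbb x y with h0 | h0
    · have := hb1 x y
      rw [if_neg hxy] at this
      have := hlt y x (by linarith)
      linarith
    · exact h0
  have hzmax : ∀ x, ¬ g z < g x := by
    intro x
    have := (Finset.mem_Icc.1 (hg_mem x)).2
    omega
  have hfz : f z = ((Finset.univ.filter (fun x => A x z)).card : ℤ) + 1 := by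
    have : Finset.univ.filter (fun x => A z x) = ∅ := by
      apply Finset.filter_eq_empty_iff.2
      intro x _ h
      exact hzmax x (hg_ord _ _ h)
    rw [hf, he, this, hz]
    simp
    ring
  have hfA : ∀ x, x ≠ z → (f x < f z ↔ A x z) := by
    intro x hx
    rw [hiff z x hx.symm, hb01]
    simp [hzmax]
  have hfinj : Function.Injective f := by
    intro x y hxy
    by_contra hne
    have h1 := hb1 x y
    rw [if_neg hne] at h1
    rcases hbb x y with h | h
    · have := hlt y x (by linarith)
      linarith
    · have := hlt x y h
      linarith
  refine ⟨hfz, hfA, ?_⟩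
  apply Finset.eq_of_subset_of_card_le
  · intro k hk
    obtain ⟨x, hx, rfl⟩ := Finset.mem_image.1 hk
    have hx : A x z := (Finset.mem_filter.1 hx).2
    have h1 := (hfA x (hA _ _ hx)).2 hx
    have h2 : 0 ≤ s x := by
      rw [hs]; exact Finset.sum_nonneg fun y _ => hb0 x y
    have h3 : f x = s x + 1 := by
      rw [hf]; simp only [s, s']; ring
    rw [Finset.mem_Icc]
    constructor <;> linarith
  · rw [Finset.card_image_of_injective _ hfinj]
    simp
end
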